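/- For each j ∈ ℕ and any two knot-like complexes C_1 and C_2, φ_j(C_1 ⊗_R C_2) = φ_j(C_1) + φ_j(C_2). Consequently φ_j descends to a group homomorphism φ_j: KL → ℤ on the local equivalence group of knot-like complexes. -/

import Mathlib

/-!
Common setup: the ring `R = 𝔽₂[U,V]/(UV = 0)`, bigraded free finitely generated chain
complexes over `R` ("pre-complexes"), knot-like complexes, local maps and local
equivalence, standard and semistandard complexes, short maps, the `Z^!` order,
the invariants `a_i`, `φ_j`, `P`, shift maps, tensor products, duals, and direct sums.
-/

set_option synthInstance.maxHeartbeats 1000000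
set_option maxHeartbeats 1000000

noncomputable section

/-- The polynomial ring `𝔽₂[U,V]`. -/
abbrev PolyUV : Type := MvPolynomial (Fin 2) (ZMod 2)

/-- The ideal `(U·V)`. -/
def IUV : Ideal PolyUV := Ideal.span {(MvPolynomial.X 0 * MvPolynomial.X 1 : PolyUV)}

/-- The ring `R = 𝔽₂[U,V]/(UV = 0)`. -/
abbrev RUV : Type := PolyUV ⧸ IUV

instance : CommRing RUV := Ideal.Quotient.commRing IUV

/-- The image of `U` in `R`. -/
def Uv : RUV := Ideal.Quotient.mk IUV (MvPolynomial.X 0)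

/-- The image of `V` in `R`. -/
def Vv : RUV := Ideal.Quotient.mk IUV (MvPolynomial.X 1)

/-- `r ∈ R` is homogeneous of bidegree `(p, q)` for the bigrading with
`gr(U) = (-2, 0)`, `gr(V) = (0, -2)`, `gr(1) = (0, 0)` (coefficients in `𝔽₂`). -/
def IsHomog (r : RUV) (p q : ℤ) : Prop :=
  r = 0 ∨ (∃ a : ℕ, r = Uv ^ a ∧ p = -(2 * (a : ℤ)) ∧ q = 0) ∨
    (∃ b : ℕ, r = Vv ^ b ∧ p = 0 ∧ q = -(2 * (b : ℤ)))

/-- A finitely generated free bigraded module over `R` with a distinguished basis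
indexed by `Fin n`, together with a bigrading `gr` on the basis and a matrix `dm`
recording a prospective differential: `dm i j` is the coefficient of the `j`-th basis
vector in the differential of the `i`-th basis vector. -/
structure PreCx where
  n : ℕ
  gr : Fin n → ℤ × ℤ
  dm : Fin n → Fin n → RUV

/-- The underlying free `R`-module of a pre-complex. -/
abbrev Msub (C : PreCx) : Type := Fin C.n →₀ RUV

/-- The differential of a pre-complex, as an `R`-linear map. -/
def dmap (C : PreCx) : Msub C →ₗ[RUV] Msub C :=
  Finsupp.linearCombination RUV fun i => ∑ j, Finsupp.single j (C.dm i j)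

/-- The submodule `U·C ⊆ C`; `C/U` is the quotient by this submodule. -/
def uSub (C : PreCx) : Submodule RUV (Msub C) :=
  LinearMap.range (LinearMap.lsmul RUV (Msub C) Uv)

/-- The submodule `V·C ⊆ C`; `C/V` is the quotient by this submodule. -/
def vSub (C : PreCx) : Submodule RUV (Msub C) :=
  LinearMap.range (LinearMap.lsmul RUV (Msub C) Vv)

/-- Chains which die in the homology of `C/U`: the preimage in `C` of the boundaries of
the induced differential on `C/U`. -/
def bdryU (C : PreCx) : Submodule RUV (Msub C) := uSub C ⊔ LinearMap.range (dmap C)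

/-- Chains which die in the homology of `C/V`. -/
def bdryV (C : PreCx) : Submodule RUV (Msub C) := vSub C ⊔ LinearMap.range (dmap C)

/-- A chain `x ∈ C` is homogeneous of bidegree `(p, q)`. -/
def ChainHomog (C : PreCx) (x : Msub C) (p q : ℤ) : Prop :=
  ∀ j, IsHomog (x j) (p - (C.gr j).1) (q - (C.gr j).2)

/-- `x` is a `V`-tower class generator: its class in `H_*(C/U)` is a `V`-nontorsion cycle
whose image generates `H_*(C/U)/(V-torsion)` (equivalently, it is maximally `V`-graded
among `V`-nontorsion classes). -/
def IsVTowerGen (C : PreCx) (x : Msub C) : Prop :=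
  dmap C x ∈ uSub C ∧ (∀ k : ℕ, Vv ^ k • x ∉ bdryU C) ∧
    ∀ z : Msub C, dmap C z ∈ uSub C →
      ∃ (r : RUV) (k : ℕ), Vv ^ k • (z - r • x) ∈ bdryU C

/-- `x` is a `U`-tower class generator: its class in `H_*(C/V)` is a `U`-nontorsion cycle
whose image generates `H_*(C/V)/(U-torsion)`. -/
def IsUTowerGen (C : PreCx) (x : Msub C) : Prop :=
  dmap C x ∈ vSub C ∧ (∀ k : ℕ, Uv ^ k • x ∉ bdryV C) ∧
    ∀ z : Msub C, dmap C z ∈ vSub C →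
      ∃ (r : RUV) (k : ℕ), Uv ^ k • (z - r • x) ∈ bdryV C

/-- `C` is a chain complex over `R` whose differential has degree `(-1, -1)`. -/
def IsCplx (C : PreCx) : Prop :=
  (∀ x, dmap C (dmap C x) = 0) ∧
    ∀ i j, IsHomog (C.dm i j) ((C.gr i).1 - 1 - (C.gr j).1) ((C.gr i).2 - 1 - (C.gr j).2)

/-- A knot-like complex: a free, finitely generated, bigraded chain complex over `R`
whose differential has degree `(-1,-1)`, such that `H_*(C/U)/(V`-torsion`) ≅ 𝔽₂[V]` with
all `V`-nontorsion elements of `H_*(C/U)` in `U`-grading `0`, and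
`H_*(C/V)/(U`-torsion`) ≅ 𝔽₂[U]` with all `U`-nontorsion elements of `H_*(C/V)` in
`V`-grading `0`. -/
structure IsKnotLike (C : PreCx) : Prop where
  dsq : ∀ x, dmap C (dmap C x) = 0
  dhomog : ∀ i j, IsHomog (C.dm i j)
    ((C.gr i).1 - 1 - (C.gr j).1) ((C.gr i).2 - 1 - (C.gr j).2)
  vTowerExists : ∃ x, IsVTowerGen C x
  vTowerGr : ∀ x p q, ChainHomog C x p q → dmap C x ∈ uSub C →
    (∀ k : ℕ, Vv ^ k • x ∉ bdryU C) → p = 0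
  uTowerExists : ∃ x, IsUTowerGen C x
  uTowerGr : ∀ x p q, ChainHomog C x p q → dmap C x ∈ vSub C →
    (∀ k : ℕ, Uv ^ k • x ∉ bdryV C) → q = 0

/-- A module map `f : C₁ → C₂` is homogeneous of bidegree `(s, t)`. -/
def MapHomogShift (C₁ C₂ : PreCx) (f : Msub C₁ →ₗ[RUV] Msub C₂) (s t : ℤ) : Prop :=
  ∀ i j, IsHomog (f (Finsupp.single i 1) j)
    ((C₁.gr i).1 + s - (C₂.gr j).1) ((C₁.gr i).2 + t - (C₂.gr j).2)

/-- A local map `f : C₁ → C₂`: an absolutely `U`-graded, relatively `V`-graded,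
`R`-equivariant chain map inducing an isomorphism on `H_*(·/U)/(V-torsion)`
(equivalently, taking `V`-tower generators to `V`-tower generators). -/
structure IsLocalMap (C₁ C₂ : PreCx) (f : Msub C₁ →ₗ[RUV] Msub C₂) : Prop where
  chain : ∀ x, f (dmap C₁ x) = dmap C₂ (f x)
  graded : ∃ s : ℤ, MapHomogShift C₁ C₂ f 0 s
  towers : ∀ x, IsVTowerGen C₁ x → IsVTowerGen C₂ (f x)

/-- `C₁ ≤ C₂`: there exists a local map `C₁ → C₂`. -/
def LocalLE (C₁ C₂ : PreCx) : Prop := ∃ f, IsLocalMap C₁ C₂ f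

/-- Local equivalence of complexes: local maps in both directions. -/
def LocalEquiv (C₁ C₂ : PreCx) : Prop := LocalLE C₁ C₂ ∧ LocalLE C₂ C₁

/-- `C` is reduced: `∂ ≡ 0 mod (U, V)`. -/
def Reduced (C : PreCx) : Prop := ∀ i j, C.dm i j ∈ Ideal.span ({Uv, Vv} : Set RUV)

/-! ### Standard complexes -/

/-- The shift in bigrading from `x_k` to `x_{k+1}` in a standard complex, where the
parameter joining them is `b` (`k` is the 0-based index of the parameter, so the
parameter is a `U`-power arrow if `k` is even and a `V`-power arrow if `k` is odd). -/
def stepShift (k : ℕ) (b : ℤ) : ℤ × ℤ :=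
  if k % 2 = 0 then
    if b < 0 then (2 * (b.natAbs : ℤ) - 1, -1) else (1 - 2 * (b.natAbs : ℤ), 1)
  else
    if b < 0 then (-1, 2 * (b.natAbs : ℤ) - 1) else (1, 1 - 2 * (b.natAbs : ℤ))

/-- Bigrading of `x_i` relative to `x_0` in the standard complex with parameters `L`. -/
def grRel (L : List ℤ) (i : ℕ) : ℤ × ℤ :=
  ∑ k ∈ Finset.range i, stepShift k (L.getD k 0)

/-- The bigrading of the standard complex of parameters `L`, normalized so that
`gr_U(x_0) = 0` and `gr_V(x_n) = 0`. -/
def stdGr (L : List ℤ) (i : Fin (L.length + 1)) : ℤ × ℤ :=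
  ((grRel L (i : ℕ)).1, (grRel L (i : ℕ)).2 - (grRel L L.length).2)

/-- The differential matrix of the standard complex of parameters `L = (b_1, …, b_n)`:
for `i` odd (1-based), `∂_U x_{i-1} = U^{|b_i|} x_i` if `b_i < 0` and
`∂_U x_i = U^{b_i} x_{i-1}` if `b_i > 0`; for `i` even the same with `V` in place of `U`;
all other differentials vanish. -/
def stdDm (L : List ℤ) (i j : Fin (L.length + 1)) : RUV :=
  if (j : ℕ) = (i : ℕ) + 1 ∧ L.getD (i : ℕ) 0 < 0 then
    (if (i : ℕ) % 2 = 0 then Uv else Vv) ^ (L.getD (i : ℕ) 0).natAbs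
  else if (i : ℕ) = (j : ℕ) + 1 ∧ 0 < L.getD (j : ℕ) 0 then
    (if (j : ℕ) % 2 = 0 then Uv else Vv) ^ (L.getD (j : ℕ) 0).natAbs
  else 0

/-- The standard complex `C(b_1, …, b_n)` of a list of parameters `L = (b_1, …, b_n)`,
with generators `x_0, …, x_n`.  (For `L = []` this is the trivial complex `R`.) -/
def StdCx (L : List ℤ) : PreCx := ⟨L.length + 1, stdGr L, stdDm L⟩

/-- `L` is a valid parameter sequence for a standard complex: all entries are nonzero
and the length is even (possibly zero). -/
def IsStdSeq (L : List ℤ) : Prop := (∀ b ∈ L, b ≠ 0) ∧ Even L.length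

/-- The trivial standard complex `C(0) = R`. -/
def trivCx : PreCx := StdCx []

/-- The bigrading of the semistandard complex `C'(b_1, …, b_n)` (`n` odd), inherited from
the ambient standard complex `C(b_1, …, b_n, 1)`. -/
def semiGr (L : List ℤ) (i : Fin (L.length + 1)) : ℤ × ℤ :=
  ((grRel L (i : ℕ)).1, (grRel L (i : ℕ)).2 - (grRel L L.length).2 + 1)

/-- The semistandard complex `C'(b_1, …, b_n)` (`n` odd): the subcomplex of
`C(b_1, …, b_n, 1)` generated by `x_0, …, x_n`. -/
def SemiStdCx (L : List ℤ) : PreCx := ⟨L.length + 1, semiGr L, stdDm L⟩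

/-! ### Tensor products, duals, direct sums -/

/-- The tensor product (over `R`) of two pre-complexes, with basis `x_i ⊗ y_j` and
differential `∂(x ⊗ y) = ∂x ⊗ y + x ⊗ ∂y` (signs are irrelevant in characteristic 2). -/
def tensorCx (C₁ C₂ : PreCx) : PreCx where
  n := C₁.n * C₂.n
  gr := fun p => C₁.gr (finProdFinEquiv.symm p).1 + C₂.gr (finProdFinEquiv.symm p).2
  dm := fun p q =>
    (if (finProdFinEquiv.symm p).2 = (finProdFinEquiv.symm q).2 then
      C₁.dm (finProdFinEquiv.symm p).1 (finProdFinEquiv.symm q).1 else 0) +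
    (if (finProdFinEquiv.symm p).1 = (finProdFinEquiv.symm q).1 then
      C₂.dm (finProdFinEquiv.symm p).2 (finProdFinEquiv.symm q).2 else 0)

/-- The dual complex `C^∨ = Hom_R(C, R)`, described on the dual basis: the gradings are
negated and the differential matrix is transposed. -/
def dualCx (C : PreCx) : PreCx := ⟨C.n, fun i => -C.gr i, fun i j => C.dm j i⟩

/-- The direct sum of two pre-complexes. -/
def sumCx (C₁ C₂ : PreCx) : PreCx where
  n := C₁.n + C₂.n
  gr := fun p => Sum.elim C₁.gr C₂.gr (finSumFinEquiv.symm p)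
  dm := fun p q =>
    match finSumFinEquiv.symm p, finSumFinEquiv.symm q with
    | Sum.inl i, Sum.inl k => C₁.dm i k
    | Sum.inr j, Sum.inr l => C₂.dm j l
    | _, _ => 0

/-- A homotopy equivalence of bigraded chain complexes over `R`: chain maps `f, g`
preserving the bigrading, with `g ∘ f ≃ id` and `f ∘ g ≃ id` via `R`-equivariant
homotopies of bidegree `(1, 1)`. -/
def HomotopyEquivCx (C₁ C₂ : PreCx) : Prop :=
  ∃ (f : Msub C₁ →ₗ[RUV] Msub C₂) (g : Msub C₂ →ₗ[RUV] Msub C₁)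
    (H : Msub C₁ →ₗ[RUV] Msub C₁) (K : Msub C₂ →ₗ[RUV] Msub C₂),
    (∀ x, f (dmap C₁ x) = dmap C₂ (f x)) ∧
    (∀ y, g (dmap C₂ y) = dmap C₁ (g y)) ∧
    MapHomogShift C₁ C₂ f 0 0 ∧ MapHomogShift C₂ C₁ g 0 0 ∧
    MapHomogShift C₁ C₁ H 1 1 ∧ MapHomogShift C₂ C₂ K 1 1 ∧
    (∀ x, g (f x) - x = dmap C₁ (H x) + H (dmap C₁ x)) ∧
    (∀ y, f (g y) - y = dmap C₂ (K y) + K (dmap C₂ y))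

/-- An isomorphism of bigraded chain complexes over `R`. -/
def IsBigradedChainIso (C₁ C₂ : PreCx) (f : Msub C₁ →ₗ[RUV] Msub C₂) : Prop :=
  Function.Bijective f ∧ (∀ x, f (dmap C₁ x) = dmap C₂ (f x)) ∧ MapHomogShift C₁ C₂ f 0 0

/-! ### Short maps -/

/-- A short map `f : C(b_1, …, b_n) ⇝ C`: an absolutely `U`-graded, relatively
`V`-graded `R`-module map which is a chain map at `x_1, …, x_{n-1}` and commutes with
the `V`-part of the differential at `x_n` (for reduced `C`, the failure
`∂ f(x_n) - f(∂_V x_n)` is exactly `∂_U f(x_n) ∈ U·C`). -/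
def IsShortMap (L : List ℤ) (C : PreCx) (f : Msub (StdCx L) →ₗ[RUV] Msub C) : Prop :=
  (∃ s : ℤ, MapHomogShift (StdCx L) C f 0 s) ∧
  (∀ i : Fin (L.length + 1), 1 ≤ (i : ℕ) → (i : ℕ) + 1 ≤ L.length →
    f (dmap (StdCx L) (Finsupp.single i 1)) = dmap C (f (Finsupp.single i 1))) ∧
  dmap C (f (Finsupp.single (Fin.last L.length) 1)) -
    f (dmap (StdCx L) (Finsupp.single (Fin.last L.length) 1)) ∈ uSub C

/-- A short local map: a short map sending the `V`-tower generator `x_0` to a `V`-tower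
generator (hence inducing an isomorphism on `H_*(·/U)/(V-torsion)`). -/
def IsShortLocalMap (L : List ℤ) (C : PreCx) (f : Msub (StdCx L) →ₗ[RUV] Msub C) : Prop :=
  IsShortMap L C f ∧ IsVTowerGen C (f (Finsupp.single (0 : Fin (L.length + 1)) 1))

/-- A local map from the semistandard complex `C'(b_1, …, b_n)` to a knot-like complex:
a grading-preserving `R`-equivariant chain map under which the class of `x_0`
generates `H_*(C/U)/(V-torsion)`. -/
def IsSemiLocalMap (L : List ℤ) (C : PreCx) (f : Msub (SemiStdCx L) →ₗ[RUV] Msub C) : Prop :=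
  (∀ x, f (dmap (SemiStdCx L) x) = dmap C (f x)) ∧
  MapHomogShift (SemiStdCx L) C f 0 0 ∧
  IsVTowerGen C (f (Finsupp.single (0 : Fin (L.length + 1)) 1))

/-! ### The order `Z^!` and the numerical invariants -/

/-- The embedding of `Z^!` into `ℚ` realizing the order
`-1 <^! -2 <^! ⋯ <^! 0 <^! ⋯ <^! 2 <^! 1`: send `0 ↦ 0` and `a ↦ 1/a` otherwise. -/
def qval (a : ℤ) : ℚ := if a = 0 then 0 else 1 / (a : ℚ)

/-- The order `≤^!` on `Z^!`. -/
def bangLE (a b : ℤ) : Prop := qval a ≤ qval b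

/-- Pad a finite sequence with trailing zeros. -/
def seqPad (L : List ℤ) (i : ℕ) : ℤ := L.getD i 0

/-- The lexicographic order on finite integer sequences induced by `≤^!`, padding the
shorter sequence with trailing zeros. -/
def bangLexLE (L₁ L₂ : List ℤ) : Prop :=
  (∀ i, seqPad L₁ i = seqPad L₂ i) ∨
    ∃ k, (∀ i < k, seqPad L₁ i = seqPad L₂ i) ∧ qval (seqPad L₁ k) < qval (seqPad L₂ k)

/-- `m` is an upper bound for `S ⊆ Z^!` with respect to `≤^!`. -/
def IsBangUB (S : Set ℤ) (m : ℤ) : Prop := ∀ b ∈ S, qval b ≤ qval m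

/-- `m = sup^! S`, the least upper bound of `S ⊆ Z^!` with respect to `≤^!`. -/
def IsBangLUB (S : Set ℤ) (m : ℤ) : Prop :=
  IsBangUB S m ∧ ∀ m' : ℤ, IsBangUB S m' → qval m ≤ qval m'

/-- Candidate set for the next invariant: given the already-constructed prefix `P`,
those nonzero `b` such that some standard complex `C(P, b, rest) ≤ C`. -/
def candSet (C : PreCx) (P : List ℤ) : Set ℤ :=
  {b | b ≠ 0 ∧ ∃ rest : List ℤ, IsStdSeq (P ++ b :: rest) ∧ LocalLE (StdCx (P ++ b :: rest)) C}

/-- `a` is the sequence of numerical invariants `a_i(C)` (indexed from `0`):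
once a term vanishes all later terms vanish, and otherwise each term is
`sup^!` of the corresponding candidate set. -/
def InvSeq (C : PreCx) (a : ℕ → ℤ) : Prop :=
  ∀ k : ℕ,
    ((∃ i < k, a i = 0) → a k = 0) ∧
    ((∀ i < k, a i ≠ 0) → IsBangLUB (candSet C ((List.range k).map a)) (a k))

/-- The first `n` terms of `a`, with the (all-zero) tail deleted. -/
def truncSeq (a : ℕ → ℤ) (n : ℕ) : List ℤ :=
  ((List.range n).map a).takeWhile (fun b => b != 0)

/-! ### The homomorphisms `φ_j`, `P` and the shifts `sh_m` -/

/-- `φ_j` of a standard complex `C(a_1, …, a_n)`: the signed count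
`#{i odd : a_i = j} − #{i odd : a_i = −j}` (with 1-based odd `i`). -/
def phi (j : ℕ) (L : List ℤ) : ℤ :=
  ∑ i ∈ Finset.range L.length,
    if i % 2 = 0 then
      (if L.getD i 0 = (j : ℤ) then 1 else 0) - (if L.getD i 0 = -(j : ℤ) then 1 else 0)
    else 0

/-- The shift `sh_m` on parameter sequences: entries of absolute value `≥ m` are pushed
one further from zero; entries of absolute value `< m` are fixed. -/
def shSeq (m : ℕ) (L : List ℤ) : List ℤ :=
  L.map fun a => if (m : ℤ) ≤ a then a + 1 else if a ≤ -(m : ℤ) then a - 1 else a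

/-- `P(C) = -2 ∑_{j>0} j φ_j(C) + ∑_i sgn a_i`, computed from the parameter sequence of
the standard representative (the sum over `j` is finite since `φ_j` vanishes for
`j` larger than any `|a_i|`). -/
def Pval (L : List ℤ) : ℤ :=
  -2 * (∑ j ∈ Finset.range ((L.map Int.natAbs).sum + 1), (j : ℤ) * phi j L) +
    (L.map Int.sign).sum

end

noncomputable section

open Polynomial Matrix
open scoped Kronecker

/-- A partial matching of `J` by oriented weighted edges: `σ` exchanges the two ends of each edge,
`sg` is `1` at a source, `-1` at a target and `0` off the matching, and `w` is the weight of the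
edge at a vertex. -/
structure Matching (J : Type) where
  σ : J → J
  sg : J → SignType
  w : J → ℕ
  invol : ∀ j, σ (σ j) = j
  sg_σ : ∀ j, sg (σ j) = -sg j
  w_σ : ∀ j, w (σ j) = w j

namespace Matching

variable {I J : Type} [DecidableEq I] [DecidableEq J] [Fintype I] [Fintype J]

/-- The coefficient of the arrow leaving `j`, when an edge of weight `a` has length `s a`. -/
def coef (m : Matching J) (s : ℕ → ℕ) (j : J) : (ZMod 2)[X] :=
  if m.sg j = 1 then X ^ s (m.w j) else 0

/-- The two-step differential over `𝔽₂[X]` attached to a matching whose edges of weight `a` have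
length `s a`. -/
def D (m : Matching J) (s : ℕ → ℕ) : Matrix J J (ZMod 2)[X] :=
  Matrix.of fun i j => if j = m.σ i then m.coef s i else 0

omit [DecidableEq J] [Fintype J] in
lemma eq_σ_iff (m : Matching J) (i j : J) : j = m.σ i ↔ i = m.σ j :=
  ⟨fun h => by rw [h, m.invol], fun h => by rw [h, m.invol]⟩

omit [DecidableEq I] [Fintype I] in
lemma D_mul_apply (m : Matching J) (s : ℕ → ℕ) (M : Matrix J I (ZMod 2)[X]) (i : J) (j : I) :
    (m.D s * M) i j = m.coef s i * M (m.σ i) j := by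
  simp [Matrix.mul_apply, D]

omit [DecidableEq I] [Fintype I] in
lemma mul_D_apply (m : Matching J) (s : ℕ → ℕ) (M : Matrix I J (ZMod 2)[X]) (i : I) (j : J) :
    (M * m.D s) i j = M i (m.σ j) * m.coef s (m.σ j) := by
  simp [Matrix.mul_apply, D, m.eq_σ_iff _ j]

/-- The change of lengths of a chain map between two matchings: it suffices to multiply the entries
joining ends of the same kind by the appropriate powers of `X`. -/
def relength (A : Matching I) (B : Matching J) (s : ℕ → ℕ) (M : Matrix I J (ZMod 2)[X]) :
    Matrix I J (ZMod 2)[X] :=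
  Matrix.of fun i j =>
    if A.sg i = -1 ∧ B.sg j = -1 ∧ A.w i < B.w j then
      X ^ (s (B.w j) - s (A.w i)) * C ((M (A.σ i) (B.σ j)).coeff 0)
    else if A.sg i = 1 ∧ B.sg j = 1 ∧ B.w j < A.w i then
      X ^ (s (A.w i) - s (B.w j)) * C ((M (A.σ i) (B.σ j)).coeff 0)
    else C ((M i j).coeff 0)

lemma coeff_zero_of_X_pow_mul_eq {p q : (ZMod 2)[X]} {a b : ℕ} (h : X ^ a * p = q * X ^ b) :
    (a < b → p.coeff 0 = 0) ∧ (a = b → p = q) ∧ (b < a → q.coeff 0 = 0) := by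
  rw [mul_comm q] at h
  refine ⟨fun hab => ?_, fun hab => ?_, fun hab => ?_⟩
  · have := congrArg (fun r => coeff r a) h
    simpa [coeff_X_pow_mul', hab.not_ge] using this
  · subst hab
    exact mul_left_cancel₀ (pow_ne_zero _ X_ne_zero) h
  · have := congrArg (fun r => coeff r b) h
    simpa [coeff_X_pow_mul', hab.not_ge] using this.symm

omit [DecidableEq J] [Fintype J] in
lemma sg_cases (m : Matching J) (j : J) : m.sg j = 0 ∨ m.sg j = 1 ∨ m.sg j = -1 := by
  rcases m.sg j with _ | _ | _ <;> decide

lemma sign_one_ne_neg_one : (1 : SignType) ≠ -1 := by decide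

lemma chain_entries {A : Matching I} {B : Matching J} {s : ℕ → ℕ} {M : Matrix I J (ZMod 2)[X]}
    (h : A.D s * M = M * B.D s) (i : I) (j : J) :
    A.coef s i * M (A.σ i) j = M i (B.σ j) * B.coef s (B.σ j) := by
  rw [← D_mul_apply, ← mul_D_apply, h]

omit [DecidableEq J] [Fintype J] in
lemma coef_σ (m : Matching J) (s : ℕ → ℕ) (j : J) :
    m.coef s (m.σ j) = if m.sg j = -1 then X ^ s (m.w j) else 0 := by
  simp only [coef, m.sg_σ, m.w_σ, neg_eq_iff_eq_neg]

lemma relength_coeff_zero {A : Matching I} {B : Matching J} {s : ℕ → ℕ} (hs : StrictMono s)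
    {M : Matrix I J (ZMod 2)[X]} (h : A.D id * M = M * B.D id) (i : I) (j : J) :
    (relength A B s M i j).coeff 0 = (M i j).coeff 0 := by
  unfold relength
  simp only [Matrix.of_apply]
  split_ifs with h1 h2
  · obtain ⟨hi, hj, hw⟩ := h1
    have := chain_entries h (A.σ i) j
    rw [coef_σ, coef_σ, if_pos hi, if_pos hj, A.invol] at this
    rw [(coeff_zero_of_X_pow_mul_eq this).1 hw]
    have := hs hw
    simp [show 0 ≠ s (B.w j) - s (A.w i) by omega]
  · obtain ⟨hi, hj, hw⟩ := h2
    have := chain_entries h i (B.σ j)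
    rw [B.invol, coef, coef, if_pos hi, if_pos hj] at this
    rw [(coeff_zero_of_X_pow_mul_eq this).2.2 hw]
    have := hs hw
    simp [show 0 ≠ s (A.w i) - s (B.w j) by omega]
  · simp

lemma relength_chain {A : Matching I} {B : Matching J} {s : ℕ → ℕ} (hs : StrictMono s)
    {M : Matrix I J (ZMod 2)[X]} (h : A.D id * M = M * B.D id) :
    A.D s * relength A B s M = relength A B s M * B.D s := by
  ext1 i j
  rw [D_mul_apply, mul_D_apply, coef_σ, coef]
  have key := chain_entries h i j
  rw [coef_σ, coef] at key
  by_cases hi : A.sg i = 1 <;> by_cases hj : B.sg j = -1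
  · rw [if_pos hi, if_pos hj] at key ⊢
    obtain ⟨k1, k2, k3⟩ := coeff_zero_of_X_pow_mul_eq key
    simp only [relength, Matrix.of_apply, A.sg_σ, B.sg_σ, A.w_σ, B.w_σ, A.invol, B.invol, hi, hj,
      neg_neg, true_and]
    rcases lt_trichotomy (A.w i) (B.w j) with hw | hw | hw
    · have := hs hw
      simp only [hw, hw.not_gt, sign_one_ne_neg_one, if_true, if_false, false_and]
      rw [← mul_assoc, ← pow_add, mul_comm]
      congr 2; omega
    · simp only [hw, k2 hw, lt_irrefl, and_false, if_false]
      exact mul_comm _ _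
    · have := hs hw
      simp only [hw, hw.not_gt, sign_one_ne_neg_one, sign_one_ne_neg_one.symm, if_true, if_false,
        false_and]
      rw [mul_comm (X ^ (s (A.w i) - s (B.w j))), mul_assoc, ← pow_add, mul_comm]
      congr 2; omega
  · rw [if_pos hi, if_neg hj, mul_zero] at key
    have k : M (A.σ i) j = 0 := by simpa using key
    simp [relength, A.sg_σ, hi, hj, k, sign_one_ne_neg_one.symm]
  · rw [if_neg hi, if_pos hj, zero_mul] at key
    have k : M i (B.σ j) = 0 := by simpa using key.symm
    simp [relength, B.sg_σ, hi, hj, k]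
  · simp [hi, hj]

omit [DecidableEq J] in
/-- A row cycle pairs with a column cocycle through the unmatched element only. -/
lemma dot_eq_of_unique (m : Matching J) {s : ℕ → ℕ} {u : J} (hu : ∀ j, m.sg j = 0 ↔ j = u)
    {x y : J → (ZMod 2)[X]} (hx : ∀ j, x (m.σ j) * m.coef s (m.σ j) = 0)
    (hy : ∀ j, m.coef s j * y (m.σ j) = 0) : ∑ j, x j * y j = x u * y u := by
  rw [Finset.sum_eq_single u _ (by simp)]
  intro j _ hj
  have h0 : m.sg j ≠ 0 := fun h => hj ((hu j).1 h)
  rcases m.sg_cases j with h | h | h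
  · exact absurd h h0
  rotate_left
  · have := hy (m.σ j)
    rw [coef_σ, m.invol, if_pos h] at this
    rw [(mul_eq_zero.1 this).resolve_left (pow_ne_zero _ X_ne_zero), mul_zero]
  · have := hx (m.σ j)
    rw [m.invol, coef, if_pos h] at this
    rw [(mul_eq_zero.1 this).resolve_right (pow_ne_zero _ X_ne_zero), zero_mul]

/-- The matching on a product underlying the tensor product of two-step complexes: each square is
cut along its shorter side. -/
def prod (m : Matching I) (n : Matching J) : Matching (I × J) where
  σ p := if m.sg p.1 ≠ 0 ∧ (n.sg p.2 = 0 ∨ m.w p.1 ≤ n.w p.2) then (m.σ p.1, p.2)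
    else (p.1, n.σ p.2)
  sg p := if m.sg p.1 ≠ 0 ∧ (n.sg p.2 = 0 ∨ m.w p.1 ≤ n.w p.2) then m.sg p.1 else n.sg p.2
  w p := if m.sg p.1 ≠ 0 ∧ (n.sg p.2 = 0 ∨ m.w p.1 ≤ n.w p.2) then m.w p.1 else n.w p.2
  invol p := by
    split_ifs with h1 h2 h2
    · simp [m.invol]
    · simp only [m.sg_σ, m.w_σ, ne_eq, SignType.neg_eq_zero_iff] at h2; exact absurd h1 h2
    · simp only [n.sg_σ, n.w_σ, SignType.neg_eq_zero_iff] at h2; exact absurd h2 h1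
    · simp [n.invol]
  sg_σ p := by
    split_ifs with h1 h2 h2
    · simp [m.sg_σ]
    · simp only [m.sg_σ, m.w_σ, ne_eq, SignType.neg_eq_zero_iff] at h2; exact absurd h1 h2
    · simp only [n.sg_σ, n.w_σ, SignType.neg_eq_zero_iff] at h2; exact absurd h2 h1
    · simp [n.sg_σ]
  w_σ p := by
    split_ifs with h1 h2 h2
    · simp [m.w_σ]
    · simp only [m.sg_σ, m.w_σ, ne_eq, SignType.neg_eq_zero_iff] at h2; exact absurd h1 h2
    · simp only [n.sg_σ, n.w_σ, SignType.neg_eq_zero_iff] at h2; exact absurd h2 h1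
    · simp [n.w_σ]

omit [DecidableEq I] [DecidableEq J] [Fintype I] [Fintype J] in
lemma prod_sg_eq_zero (m : Matching I) (n : Matching J) (p : I × J) :
    (m.prod n).sg p = 0 ↔ m.sg p.1 = 0 ∧ n.sg p.2 = 0 := by
  simp only [prod]; split_ifs with h <;> tauto

/-- The differential of the tensor product of the two-step complexes of `m` and `n`. -/
def tensorD (m : Matching I) (n : Matching J) (s : ℕ → ℕ) : Matrix (I × J) (I × J) (ZMod 2)[X] :=
  m.D s ⊗ₖ 1 + 1 ⊗ₖ n.D s

/-- The off-diagonal coefficients of `basisChange`. -/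
def diagCoef (m : Matching I) (n : Matching J) (s : ℕ → ℕ) (p : I × J) : (ZMod 2)[X] :=
  if m.sg p.1 = -1 ∧ n.sg p.2 = 1 ∧ m.w p.1 ≤ n.w p.2 then X ^ (s (n.w p.2) - s (m.w p.1))
  else if m.sg p.1 = 1 ∧ n.sg p.2 = -1 ∧ n.w p.2 < m.w p.1 then X ^ (s (m.w p.1) - s (n.w p.2))
  else 0

/-- The change of basis splitting each square of the tensor product into two edges. -/
def basisChange (m : Matching I) (n : Matching J) (s : ℕ → ℕ) :
    Matrix (I × J) (I × J) (ZMod 2)[X] :=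
  1 + Matrix.of fun p q => if q = (m.σ p.1, n.σ p.2) then diagCoef m n s p else 0

lemma basisChange_mul_apply {K : Type} (m : Matching I) (n : Matching J) (s : ℕ → ℕ)
    (M : Matrix (I × J) K (ZMod 2)[X]) (p : I × J) (k : K) :
    (basisChange m n s * M) p k = M p k + diagCoef m n s p * M (m.σ p.1, n.σ p.2) k := by
  rw [basisChange, Matrix.add_mul, Matrix.one_mul, Matrix.add_apply, Matrix.mul_apply]
  simp only [Matrix.of_apply, ite_mul, zero_mul]
  rw [Finset.sum_ite_eq' Finset.univ (m.σ p.1, n.σ p.2)]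
  simp

omit [Fintype I] [Fintype J] in
lemma basisChange_apply (m : Matching I) (n : Matching J) (s : ℕ → ℕ) (p q : I × J) :
    basisChange m n s p q = (if p = q then 1 else 0) +
      if q = (m.σ p.1, n.σ p.2) then diagCoef m n s p else 0 := by
  simp [basisChange, Matrix.one_apply]

omit [DecidableEq I] [DecidableEq J] [Fintype I] [Fintype J] in
lemma diagCoef_mul_σ (m : Matching I) (n : Matching J) (s t : ℕ → ℕ) (p : I × J) :
    diagCoef m n s p * diagCoef m n t (m.σ p.1, n.σ p.2) = 0 := by
  simp only [diagCoef, m.sg_σ, n.sg_σ, m.w_σ, n.w_σ]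
  rcases m.sg_cases p.1 with h | h | h <;> rcases n.sg_cases p.2 with h' | h' | h' <;>
    simp +decide only [h, h', true_and, false_and, if_false, mul_zero] <;>
    split_ifs <;> first | omega | simp

lemma basisChange_mul_self (m : Matching I) (n : Matching J) (s : ℕ → ℕ) :
    basisChange m n s * basisChange m n s = 1 := by
  ext1 p q
  rw [basisChange_mul_apply, basisChange_apply, basisChange_apply, mul_add]
  simp only [mul_ite, mul_zero, diagCoef_mul_σ, ite_self, add_zero, mul_one, @eq_comm _ q]
  rw [add_assoc, CharTwo.add_self_eq_zero, add_zero, Matrix.one_apply]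

omit [Fintype I] [Fintype J] in
lemma tensorD_apply (m : Matching I) (n : Matching J) (s : ℕ → ℕ) (p q : I × J) :
    tensorD m n s p q = (if q = (m.σ p.1, p.2) then m.coef s p.1 else 0) +
      if q = (p.1, n.σ p.2) then n.coef s p.2 else 0 := by
  simp only [tensorD, Matrix.add_apply, Matrix.kroneckerMap_apply, D, Matrix.of_apply,
    Matrix.one_apply, Prod.ext_iff]
  congr 1
  · split_ifs <;> simp_all
  · split_ifs <;> simp_all

lemma basisChange_intertwines (m : Matching I) (n : Matching J) {s : ℕ → ℕ} (hs : StrictMono s) :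
    basisChange m n s * tensorD m n s = (m.prod n).D s * basisChange m n s := by
  ext1 p q
  rw [basisChange_mul_apply, D_mul_apply, tensorD_apply, tensorD_apply, basisChange_apply]
  obtain ⟨i, k⟩ := p
  simp only [m.invol, n.invol, coef, diagCoef, prod, m.sg_σ, n.sg_σ, m.w_σ, n.w_σ]
  have hcmp : (n.w k < m.w i ∧ ¬m.w i ≤ n.w k ∧ s (n.w k) ≤ s (m.w i)) ∨
      (¬n.w k < m.w i ∧ m.w i ≤ n.w k ∧ s (m.w i) ≤ s (n.w k)) :=
    (lt_or_ge (n.w k) (m.w i)).imp (fun h => ⟨h, h.not_ge, hs.monotone h.le⟩)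
      (fun h => ⟨not_lt_of_ge h, h, hs.monotone h⟩)
  rcases m.sg_cases i with h | h | h <;> rcases n.sg_cases k with h' | h' | h' <;>
    rcases hcmp with ⟨hw, hw', hle⟩ | ⟨hw, hw', hle⟩ <;>
    (simp +decide only [h, h', hw, hw', and_true, and_false,
      if_false, if_true, zero_mul, mul_zero, ite_self, add_zero, zero_add, or_true, or_false,
      m.sg_σ, n.sg_σ, m.w_σ, n.w_σ, m.invol, n.invol, mul_ite, ← pow_add, mul_one, mul_add,
      Nat.add_sub_cancel' hle, Nat.sub_add_cancel hle, @eq_comm _ q, CharTwo.add_self_eq_zero]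
     try exact add_comm _ _)

end Matching

namespace Matching

variable {I J K : Type} [DecidableEq I] [DecidableEq J] [DecidableEq K]
  [Fintype I] [Fintype J] [Fintype K]

omit [Fintype I] [Fintype J] in
lemma basisChange_coeff_zero (m : Matching I) (n : Matching J) {s : ℕ → ℕ} (hs : StrictMono s) :
    (basisChange m n s).map constantCoeff = (basisChange m n id).map constantCoeff := by
  ext1 p q
  simp only [Matrix.map_apply, basisChange_apply, map_add, apply_ite constantCoeff, map_zero]
  congr 2
  have key : ∀ a b, (coeff (X ^ (s a - s b) : (ZMod 2)[X]) 0) =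
      coeff (X ^ (a - b) : (ZMod 2)[X]) 0 := by
    intro a b
    have : s a ≤ s b ↔ a ≤ b := hs.le_iff_le
    simp only [coeff_X_pow, eq_comm (a := 0), Nat.sub_eq_zero_iff_le, this]
  simp only [diagCoef, apply_ite constantCoeff, map_zero, constantCoeff_apply, key, id]

lemma tensorD_mul_basisChange (m : Matching I) (n : Matching J) {s : ℕ → ℕ} (hs : StrictMono s) :
    tensorD m n s * basisChange m n s = basisChange m n s * (m.prod n).D s := by
  have h := basisChange_intertwines m n hs
  calc tensorD m n s * basisChange m n s
      = basisChange m n s * (basisChange m n s * tensorD m n s) * basisChange m n s := by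
        rw [← Matrix.mul_assoc, basisChange_mul_self, Matrix.one_mul]
    _ = _ := by
        rw [h, Matrix.mul_assoc, Matrix.mul_assoc, basisChange_mul_self, Matrix.mul_one]

/-- Chain maps into a tensor product survive every strictly increasing change of lengths. -/
lemma exists_relength_into_tensor (A : Matching K) (m : Matching I) (n : Matching J) {s : ℕ → ℕ}
    (hs : StrictMono s) {M : Matrix K (I × J) (ZMod 2)[X]}
    (h : A.D id * M = M * tensorD m n id) :
    ∃ M' : Matrix K (I × J) (ZMod 2)[X], A.D s * M' = M' * tensorD m n s ∧
      M'.map constantCoeff = M.map constantCoeff := by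
  have h1 : A.D id * (M * basisChange m n id) = M * basisChange m n id * (m.prod n).D id := by
    rw [← Matrix.mul_assoc, h, Matrix.mul_assoc, tensorD_mul_basisChange m n strictMono_id,
      Matrix.mul_assoc]
  refine ⟨relength A (m.prod n) s (M * basisChange m n id) * basisChange m n s, ?_, ?_⟩
  · rw [← Matrix.mul_assoc, relength_chain hs h1, Matrix.mul_assoc, Matrix.mul_assoc,
      basisChange_intertwines m n hs]
  · have h2 : (relength A (m.prod n) s (M * basisChange m n id)).map constantCoeff =
        (M * basisChange m n id).map constantCoeff := by
      ext1 i j; exact relength_coeff_zero hs h1 i j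
    rw [Matrix.map_mul, h2, basisChange_coeff_zero m n hs, ← Matrix.map_mul, Matrix.mul_assoc,
      basisChange_mul_self, Matrix.mul_one]

/-- Chain maps out of a tensor product survive every strictly increasing change of lengths. -/
lemma exists_relength_out_of_tensor (A : Matching K) (m : Matching I) (n : Matching J) {s : ℕ → ℕ}
    (hs : StrictMono s) {N : Matrix (I × J) K (ZMod 2)[X]}
    (h : tensorD m n id * N = N * A.D id) :
    ∃ N' : Matrix (I × J) K (ZMod 2)[X], tensorD m n s * N' = N' * A.D s ∧
      N'.map constantCoeff = N.map constantCoeff := by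
  have h1 : (m.prod n).D id * (basisChange m n id * N) = basisChange m n id * N * A.D id := by
    rw [← Matrix.mul_assoc, ← basisChange_intertwines m n strictMono_id, Matrix.mul_assoc, h,
      Matrix.mul_assoc]
  refine ⟨basisChange m n s * relength (m.prod n) A s (basisChange m n id * N), ?_, ?_⟩
  · rw [← Matrix.mul_assoc, tensorD_mul_basisChange m n hs, Matrix.mul_assoc, relength_chain hs h1,
      Matrix.mul_assoc]
  · have h2 : (relength (m.prod n) A s (basisChange m n id * N)).map constantCoeff =
        (basisChange m n id * N).map constantCoeff := by
      ext1 i j; exact relength_coeff_zero hs h1 i j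
    rw [Matrix.map_mul, h2, basisChange_coeff_zero m n hs, ← Matrix.map_mul, ← Matrix.mul_assoc,
      basisChange_mul_self, Matrix.one_mul]

/-- A composite through a tensor product factors, on the unmatched generator, through the unmatched
generator of the tensor product. -/
lemma mul_apply_unmatched {A : Matching K} {m : Matching I} {n : Matching J} {s : ℕ → ℕ}
    (hs : StrictMono s) {M : Matrix K (I × J) (ZMod 2)[X]} {N : Matrix (I × J) K (ZMod 2)[X]}
    (hM : A.D s * M = M * tensorD m n s) (hN : tensorD m n s * N = N * A.D s)
    {u : K} {x : I} {y : J} (hu : A.sg u = 0) (hx : ∀ i, m.sg i = 0 ↔ i = x)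
    (hy : ∀ i, n.sg i = 0 ↔ i = y) : (M * N) u u = M u (x, y) * N (x, y) u := by
  have h1 : A.D s * (M * basisChange m n s) = M * basisChange m n s * (m.prod n).D s := by
    rw [← Matrix.mul_assoc, hM, Matrix.mul_assoc, tensorD_mul_basisChange m n hs,
      Matrix.mul_assoc]
  have h2 : (m.prod n).D s * (basisChange m n s * N) = basisChange m n s * N * A.D s := by
    rw [← Matrix.mul_assoc, ← basisChange_intertwines m n hs, Matrix.mul_assoc, hN,
      Matrix.mul_assoc]
  have h3 : (M * N) u u = (M * basisChange m n s * (basisChange m n s * N)) u u := by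
    rw [Matrix.mul_assoc, ← Matrix.mul_assoc (basisChange m n s), basisChange_mul_self,
      Matrix.one_mul]
  have hd : ∀ p, (x, y) = (m.σ p.1, n.σ p.2) → diagCoef m n s p = 0 := by
    intro p hp
    have hp1 := congrArg m.sg (Prod.mk.inj hp).1
    rw [(hx x).2 rfl, m.sg_σ] at hp1
    have : m.sg p.1 = 0 := SignType.neg_eq_zero_iff.1 hp1.symm
    simp +decide [diagCoef, this]
  rw [h3, Matrix.mul_apply, (m.prod n).dot_eq_of_unique (s := s) (u := (x, y))
    (fun p => by rw [prod_sg_eq_zero, hx, hy, Prod.ext_iff])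
    (fun p => by rw [← mul_D_apply, ← h1, D_mul_apply]; simp [coef, hu])
    (fun p => by rw [← D_mul_apply, h2, mul_D_apply, coef_σ]; simp [hu])]
  congr 1
  · rw [Matrix.mul_apply, Finset.sum_eq_single (x, y) _ (by simp)]
    · rw [basisChange_apply, if_pos rfl, ite_eq_right_iff.2 (hd _), add_zero, mul_one]
    · intro p _ hp
      rw [basisChange_apply, if_neg hp, ite_eq_right_iff.2 (hd _), add_zero, mul_zero]
  · rw [basisChange_mul_apply]
    have : m.sg x = 0 := (hx x).2 rfl
    simp +decide [diagCoef, this]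

end Matching

namespace Matching

variable {I J K : Type} [DecidableEq I] [DecidableEq J] [DecidableEq K]
  [Fintype I] [Fintype J] [Fintype K]

/-- The part of a polynomial of degree `k / 2`, so that `X` has weight `2`. -/
def weightPart (k : ℤ) : (ZMod 2)[X] →+ (ZMod 2)[X] :=
  if 0 ≤ k ∧ 2 ∣ k then
    ((monomial (k / 2).toNat).comp (lcoeff (ZMod 2) (k / 2).toNat)).toAddMonoidHom
  else 0

/-- The part of weight `k` of a polynomial when `X` has weight zero. -/
def constPart (k : ℤ) : (ZMod 2)[X] →+ (ZMod 2)[X] :=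
  if k = 0 then AddMonoidHom.id _ else 0

lemma weightPart_two_mul (e : ℕ) (p : (ZMod 2)[X]) :
    weightPart (2 * e) p = monomial e (p.coeff e) := by
  simp [weightPart]

lemma weightPart_eq_zero {k : ℤ} (h : ∀ e : ℕ, k ≠ 2 * e) : weightPart k = 0 := by
  rw [weightPart, if_neg]
  rintro ⟨h1, e, rfl⟩
  exact h e.toNat (by omega)

lemma weightPart_X_pow_mul (k : ℤ) (w : ℕ) (p : (ZMod 2)[X]) :
    weightPart (k + 2 * w) (X ^ w * p) = X ^ w * weightPart k p := by
  by_cases h : ∃ e : ℕ, k = 2 * e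
  · obtain ⟨e, rfl⟩ := h
    rw [show (2 * e + 2 * w : ℤ) = 2 * ((e + w : ℕ) : ℤ) by push_cast; ring, weightPart_two_mul,
      weightPart_two_mul, coeff_X_pow_mul, X_pow_mul_monomial]
  · push Not at h
    rw [weightPart_eq_zero h, AddMonoidHom.zero_apply, mul_zero]
    by_cases h' : ∃ e : ℕ, k + 2 * w = 2 * e
    · obtain ⟨e, he⟩ := h'
      rw [he, weightPart_two_mul, coeff_X_pow_mul', if_neg, monomial_zero_right]
      intro hw
      exact h (e - w) (by omega)
    · push Not at h'
      rw [weightPart_eq_zero h', AddMonoidHom.zero_apply]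

lemma weightPart_coeff_zero (k : ℤ) (p : (ZMod 2)[X]) :
    (weightPart k p).coeff 0 = if k = 0 then p.coeff 0 else 0 := by
  by_cases h : ∃ e : ℕ, k = 2 * e
  · obtain ⟨e, rfl⟩ := h
    rw [weightPart_two_mul, coeff_monomial]
    rcases Nat.eq_zero_or_pos e with rfl | he
    · simp
    · rw [if_neg he.ne', if_neg (by omega)]
  · push Not at h
    rw [weightPart_eq_zero h, if_neg (by simpa using h 0)]
    simp

lemma constPart_coeff_zero (k : ℤ) (p : (ZMod 2)[X]) :
    (constPart k p).coeff 0 = if k = 0 then p.coeff 0 else 0 := by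
  unfold constPart; split_ifs <;> simp

/-- The matrix `d` has degree `-1` for the grading `g` of its index set, with respect to a
decomposition of polynomials into weights. -/
def IsDegNegOne (part : ℤ → (ZMod 2)[X] →+ (ZMod 2)[X]) (g : I → ℤ)
    (d : Matrix I I (ZMod 2)[X]) : Prop :=
  ∀ i j k p, part (k + g j - g i + 1) (d i j * p) = d i j * part k p

omit [DecidableEq I] [DecidableEq J] in
/-- The degree-preserving part of a chain map is a chain map. -/
lemma chain_part {part : ℤ → (ZMod 2)[X] →+ (ZMod 2)[X]} {g : I → ℤ} {h : J → ℤ}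
    {d : Matrix I I (ZMod 2)[X]} {e : Matrix J J (ZMod 2)[X]} (hd : IsDegNegOne part g d)
    (he : IsDegNegOne part h e) {M : Matrix I J (ZMod 2)[X]} (hM : d * M = M * e) :
    d * (Matrix.of fun i j => part (h j - g i) (M i j)) =
      (Matrix.of fun i j => part (h j - g i) (M i j)) * e := by
  ext1 i j
  have key := congrArg (part (h j - g i + 1)) (congrFun (congrFun hM i) j)
  simp only [Matrix.mul_apply, map_sum] at key
  simp only [Matrix.mul_apply, Matrix.of_apply]
  refine Eq.trans (Eq.trans ?_ key) ?_
  · refine Finset.sum_congr rfl fun l _ => ?_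
    rw [← hd i l]
    congr 1; congr 1; ring
  · refine Finset.sum_congr rfl fun l _ => ?_
    rw [mul_comm (M i l), mul_comm _ (e l j), ← he l j]
    congr 1; congr 1; ring

omit [Fintype I] in
lemma D_isDegNegOne {part : ℤ → (ZMod 2)[X] →+ (ZMod 2)[X]} {g : I → ℤ} {A : Matching I}
    {s : ℕ → ℕ} (h : ∀ i, A.sg i = 1 → ∀ k p,
      part (k + g (A.σ i) - g i + 1) (X ^ s (A.w i) * p) = X ^ s (A.w i) * part k p) :
    IsDegNegOne part g (A.D s) := by
  intro i j k p
  simp only [D, Matrix.of_apply, coef]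
  split_ifs with h1 h2
  · rw [h1, h i h2]
  · simp
  · simp

omit [Fintype I] [Fintype J] in
lemma tensorD_isDegNegOne {part : ℤ → (ZMod 2)[X] →+ (ZMod 2)[X]} {g : I → ℤ} {h : J → ℤ}
    {m : Matching I} {n : Matching J} {s : ℕ → ℕ} (hm : IsDegNegOne part g (m.D s))
    (hn : IsDegNegOne part h (n.D s)) :
    IsDegNegOne part (fun p : I × J => g p.1 + h p.2) (tensorD m n s) := by
  rintro ⟨i, i'⟩ ⟨j, j'⟩ k p
  simp only [tensorD, Matrix.add_apply, Matrix.kroneckerMap_apply, Matrix.one_apply, add_mul,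
    map_add]
  congr 1
  · split_ifs with h1
    · subst h1
      rw [mul_one, ← hm]; congr 1; congr 1; ring
    · simp
  · split_ifs with h1
    · subst h1
      rw [one_mul, ← hn]; congr 1; congr 1; ring
    · simp

/-- The coefficient of `i` in the image of `i` is constant along the matching. -/
lemma diag_σ {A : Matching K} {s : ℕ → ℕ} {P : Matrix K K (ZMod 2)[X]}
    (h : A.D s * P = P * A.D s) {u : K} (hu : ∀ i, A.sg i = 0 ↔ i = u) (i : K) :
    P (A.σ i) (A.σ i) = P i i := by
  have key : ∀ i, A.sg i = 1 → P (A.σ i) (A.σ i) = P i i := by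
    intro i hi
    have := chain_entries h i (A.σ i)
    rw [A.invol, coef, if_pos hi, mul_comm] at this
    exact mul_right_cancel₀ (pow_ne_zero _ X_ne_zero) this
  rcases A.sg_cases i with hi | hi | hi
  · have h1 : A.sg (A.σ i) = 0 := by rw [A.sg_σ, hi]; decide
    rw [(hu _).1 h1, (hu _).1 hi]
  · exact key i hi
  · have := key (A.σ i) (by rw [A.sg_σ, hi]; decide)
    rw [A.invol] at this
    exact this.symm

/-- The two matchings underlying a standard complex, for the `U`-arrows and the `V`-arrows, with a
grading `g` for which `U`-arrows of length `a` have degree `2 * a - 1` and `V`-arrows degree `-1`. -/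
structure IsZigzag (A B : Matching K) (s : ℕ → ℕ) (g : K → ℤ) (u v : K) : Prop where
  unmatched_left : ∀ i, A.sg i = 0 ↔ i = u
  unmatched_right : ∀ i, B.sg i = 0 ↔ i = v
  gr_left : ∀ i, A.sg i = 1 → g (A.σ i) = g i - 1 + 2 * s (A.w i)
  gr_right : ∀ i, B.sg i = 1 → g (B.σ i) = g i - 1
  gr_start : g v = 0
  connected : ∀ P : K → Prop, P v → (∀ i, P i → P (A.σ i)) → (∀ i, P i → P (B.σ i)) → P u

omit [Fintype K] in
lemma IsZigzag.left_isDegNegOne {A B : Matching K} {s : ℕ → ℕ} {g : K → ℤ} {u v : K}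
    (h : IsZigzag A B s g u v) : IsDegNegOne weightPart g (A.D s) :=
  D_isDegNegOne fun i hi k p => by
    rw [h.gr_left i hi, ← weightPart_X_pow_mul]; congr 1; congr 1; ring

omit [Fintype K] in
lemma IsZigzag.right_isDegNegOne {A B : Matching K} {s : ℕ → ℕ} {g : K → ℤ} {u v : K}
    (h : IsZigzag A B s g u v) : IsDegNegOne constPart g (B.D id) :=
  D_isDegNegOne fun i hi k p => by
    rw [h.gr_right i hi, show k + (g i - 1) - g i + 1 = k by ring]
    unfold constPart; split_ifs <;> simp

/-- Additivity of the grading of the `U`-tower generator: local maps in both directions between a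
zigzag and a tensor product of zigzags force the gradings to add, for every change of lengths of
the `U`-arrows. -/
theorem gr_eq_add {A B : Matching K} {m m' : Matching I} {n n' : Matching J} {s : ℕ → ℕ}
    (hs : StrictMono s) {g : K → ℤ} {g₁ : I → ℤ} {g₂ : J → ℤ} {u v : K} {u₁ v₁ : I} {u₂ v₂ : J}
    (hA : IsZigzag A B s g u v) (hm : IsZigzag m m' s g₁ u₁ v₁) (hn : IsZigzag n n' s g₂ u₂ v₂)
    {M M' : Matrix K (I × J) (ZMod 2)[X]} {N N' : Matrix (I × J) K (ZMod 2)[X]}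
    (hM : A.D id * M = M * tensorD m n id) (hM' : B.D id * M' = M' * tensorD m' n' id)
    (hN : tensorD m n id * N = N * A.D id) (hN' : tensorD m' n' id * N' = N' * B.D id)
    (hMM : M.map constantCoeff = M'.map constantCoeff)
    (hNN : N.map constantCoeff = N'.map constantCoeff)
    (hM0 : (M' v (v₁, v₂)).coeff 0 ≠ 0) (hN0 : (N' (v₁, v₂) v).coeff 0 ≠ 0) :
    g u = g₁ u₁ + g₂ u₂ := by
  obtain ⟨Ms, hMs, hMs0⟩ := exists_relength_into_tensor A m n hs hM
  obtain ⟨Ns, hNs, hNs0⟩ := exists_relength_out_of_tensor A m n hs hN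
  have hP := chain_part hA.left_isDegNegOne
    (tensorD_isDegNegOne hm.left_isDegNegOne hn.left_isDegNegOne) hMs
  have hP' := chain_part hA.right_isDegNegOne
    (tensorD_isDegNegOne hm.right_isDegNegOne hn.right_isDegNegOne) hM'
  set P : Matrix K (I × J) (ZMod 2)[X] :=
    Matrix.of fun i j => weightPart (g₁ j.1 + g₂ j.2 - g i) (Ms i j) with hPdef
  set P' : Matrix K (I × J) (ZMod 2)[X] :=
    Matrix.of fun i j => constPart (g₁ j.1 + g₂ j.2 - g i) (M' i j) with hPdef'
  have hPP : P.map constantCoeff = P'.map constantCoeff := by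
    ext1 i j
    have h1 : (Ms i j).coeff 0 = (M' i j).coeff 0 :=
      congrFun (congrFun (hMs0.trans hMM) i) j
    simp only [hPdef, hPdef', Matrix.map_apply, Matrix.of_apply, constantCoeff_apply,
      weightPart_coeff_zero, constPart_coeff_zero, h1]
  have hQ : (P * Ns).map constantCoeff = (P' * N').map constantCoeff := by
    rw [Matrix.map_mul, Matrix.map_mul, hPP, hNs0, hNN]
  have hQ' : ∀ i, ((P * Ns) i i).coeff 0 = ((P' * N') i i).coeff 0 := fun i =>
    congrFun (congrFun hQ i) i
  have hc : A.D s * (P * Ns) = P * Ns * A.D s := by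
    rw [← Matrix.mul_assoc, hP, Matrix.mul_assoc, hNs, Matrix.mul_assoc]
  have hc' : B.D id * (P' * N') = P' * N' * B.D id := by
    rw [← Matrix.mul_assoc, hP', Matrix.mul_assoc, hN', Matrix.mul_assoc]
  have hu := hA.connected (fun i => ((P * Ns) i i).coeff 0 ≠ 0) (by
      rw [hQ', mul_apply_unmatched strictMono_id hP' hN' ((hA.unmatched_right v).2 rfl)
        hm.unmatched_right hn.unmatched_right, mul_coeff_zero]
      refine mul_ne_zero ?_ hN0
      rw [hPdef', Matrix.of_apply, constPart_coeff_zero, if_pos]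
      · exact hM0
      · simp [hA.gr_start, hm.gr_start, hn.gr_start])
    (fun i hi => by rwa [diag_σ hc hA.unmatched_left])
    (fun i hi => by
      rw [hQ'] at hi ⊢
      rwa [diag_σ hc' hA.unmatched_right])
  rw [mul_apply_unmatched hs hP hNs ((hA.unmatched_left u).2 rfl)
        hm.unmatched_left hn.unmatched_left, mul_coeff_zero, hPdef, Matrix.of_apply,
        weightPart_coeff_zero] at hu
  by_contra hne
  rw [if_neg (fun h => hne (by linarith)), zero_mul] at hu
  exact hu rfl

end Matching

section

/-- The parameter of the arrow at `x_i` joining generators `x_k, x_{k+1}` with `k + par` even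
(zero if there is none). -/
def edgeParam (L : List ℤ) (par i : ℕ) : ℤ :=
  if (i + par) % 2 = 0 then L.getD i 0 else if i = 0 then 0 else L.getD (i - 1) 0

lemma getD_eq_zero_of_le {L : List ℤ} {i : ℕ} (h : L.length ≤ i) : L.getD i 0 = 0 :=
  List.getD_eq_default _ _ h

lemma getD_ne_zero {L : List ℤ} (hL : ∀ b ∈ L, b ≠ 0) {i : ℕ} (h : i < L.length) :
    L.getD i 0 ≠ 0 := by
  rw [List.getD_eq_getElem _ _ h]
  exact hL _ (List.getElem_mem h)

/-- The generator of a standard complex joined to `x_i` by an arrow between some `x_k, x_{k+1}`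
with `k + par` even. -/
def stdPartner (L : List ℤ) (par : ℕ) (i : Fin (L.length + 1)) : Fin (L.length + 1) :=
  if ((i : ℕ) + par) % 2 = 0 then (if h : (i : ℕ) < L.length then ⟨(i : ℕ) + 1, by omega⟩ else i)
  else ⟨(i : ℕ) - 1, by omega⟩

lemma stdPartner_val (L : List ℤ) (par : ℕ) (i : Fin (L.length + 1)) :
    (stdPartner L par i : ℕ) =
      if ((i : ℕ) + par) % 2 = 0 then (if (i : ℕ) < L.length then (i : ℕ) + 1 else i) else (i : ℕ) - 1 := by
  unfold stdPartner; split_ifs <;> rfl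

lemma edgeParam_stdPartner (L : List ℤ) (par : ℕ) (i : Fin (L.length + 1)) :
    edgeParam L par (stdPartner L par i : ℕ) = edgeParam L par (i : ℕ) := by
  unfold edgeParam
  rw [stdPartner_val]
  by_cases h1 : ((i : ℕ) + par) % 2 = 0
  · by_cases h2 : (i : ℕ) < L.length
    · simp [h1, h2, show ((i : ℕ) + 1 + par) % 2 ≠ 0 by omega]
    · simp [h1, h2]
  · by_cases h2 : (i : ℕ) = 0
    · simp [h2, show par % 2 = 1 by omega]
    · simp [h1, h2, show ((i : ℕ) - 1 + par) % 2 = 0 by omega]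

/-- The sign of the arrow of `stdPartner` at `x_i`: `1` if it starts there and `-1` if it ends
there. -/
def stdSign (L : List ℤ) (par : ℕ) (i : Fin (L.length + 1)) : SignType :=
  if ((i : ℕ) + par) % 2 = 0 then -SignType.sign (edgeParam L par (i : ℕ))
  else SignType.sign (edgeParam L par (i : ℕ))

lemma stdSign_stdPartner (L : List ℤ) (par : ℕ) (i : Fin (L.length + 1)) :
    stdSign L par (stdPartner L par i) = -stdSign L par i := by
  unfold stdSign
  rw [edgeParam_stdPartner, stdPartner_val]
  by_cases h1 : ((i : ℕ) + par) % 2 = 0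
  · by_cases h2 : (i : ℕ) < L.length
    · simp [h1, h2, show ((i : ℕ) + 1 + par) % 2 ≠ 0 by omega]
    · simp [h1, h2, edgeParam]
  · by_cases h2 : (i : ℕ) = 0
    · simp [h2, edgeParam, show par % 2 = 1 by omega]
    · simp [h1, show ((i : ℕ) - 1 + par) % 2 = 0 by omega]

/-- The matching of the generators of a standard complex by its `U`-arrows (`par = 0`) or its
`V`-arrows (`par = 1`). -/
def stdMatching (L : List ℤ) (par : ℕ) : Matching (Fin (L.length + 1)) where
  σ := stdPartner L par
  sg := stdSign L par
  w i := (edgeParam L par (i : ℕ)).natAbs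
  invol i := by
    apply Fin.ext
    rw [stdPartner_val, stdPartner_val]
    split_ifs <;> omega
  sg_σ := stdSign_stdPartner L par
  w_σ i := by rw [edgeParam_stdPartner]

lemma lt_length_of_getD_ne_zero {L : List ℤ} {i : ℕ} (h : L.getD i 0 ≠ 0) : i < L.length := by
  by_contra h'
  exact h (getD_eq_zero_of_le (not_lt.1 h'))

lemma stdSign_eq_one_iff (L : List ℤ) (par : ℕ) (i : Fin (L.length + 1)) :
    stdSign L par i = 1 ↔
      (((i : ℕ) + par) % 2 = 0 ∧ L.getD (i : ℕ) 0 < 0) ∨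
        (((i : ℕ) + par) % 2 ≠ 0 ∧ (i : ℕ) ≠ 0 ∧ 0 < L.getD ((i : ℕ) - 1) 0) := by
  unfold stdSign edgeParam
  by_cases h1 : ((i : ℕ) + par) % 2 = 0
  · simp [h1, neg_eq_iff_eq_neg, sign_eq_neg_one_iff]
  · by_cases h2 : (i : ℕ) = 0
    · simp [h2, show par % 2 = 1 by omega]
    · simp [h1, h2, sign_eq_one_iff]

lemma stdSign_eq_zero_iff (L : List ℤ) (par : ℕ) (i : Fin (L.length + 1)) :
    stdSign L par i = 0 ↔ edgeParam L par (i : ℕ) = 0 := by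
  unfold stdSign
  split_ifs <;> simp [SignType.neg_eq_zero_iff, sign_eq_zero_iff]

lemma stdMatching_D_apply (L : List ℤ) (par : ℕ) (i j : Fin (L.length + 1)) :
    (stdMatching L par).D id i j =
      if (j : ℕ) = (i : ℕ) + 1 ∧ L.getD (i : ℕ) 0 < 0 then
        (if ((i : ℕ) + par) % 2 = 0 then X ^ (L.getD (i : ℕ) 0).natAbs else 0)
      else if (i : ℕ) = (j : ℕ) + 1 ∧ 0 < L.getD (j : ℕ) 0 then
        (if ((j : ℕ) + par) % 2 = 0 then X ^ (L.getD (j : ℕ) 0).natAbs else 0)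
      else 0 := by
  have hlt := @lt_length_of_getD_ne_zero L (i : ℕ)
  simp only [Matching.D, Matching.coef, stdMatching, Matrix.of_apply, Fin.ext_iff, stdPartner_val,
    stdSign_eq_one_iff, edgeParam, id]
  by_cases h1 : ((i : ℕ) + par) % 2 = 0
  · by_cases h2 : L.getD (i : ℕ) 0 < 0
    · have := hlt h2.ne
      by_cases h3 : (j : ℕ) = (i : ℕ) + 1
      · simp only [h1, h2, h3, this, if_true, and_self, true_or]
      · have : ¬ ((i : ℕ) = (j : ℕ) + 1 ∧ ((j : ℕ) + par) % 2 = 0) := by omega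
        simp only [h1, h2, h3]
        grind
    · have : ¬ ((i : ℕ) = (j : ℕ) + 1 ∧ ((j : ℕ) + par) % 2 = 0) := by omega
      grind
  · by_cases h2 : (i : ℕ) = (j : ℕ) + 1
    · have : ((j : ℕ) + par) % 2 = 0 := by omega
      have h3 : (i : ℕ) - 1 = j := by omega
      have h4 : ¬ ((j : ℕ) = (i : ℕ) + 1) := by omega
      simp [h1, h3, h4, this, show ¬ (i : ℕ) = 0 by omega]
      grind
    · have : (i : ℕ) ≠ 0 → (j : ℕ) ≠ (i : ℕ) - 1 := by omega
      grind

/-- The `U`-grading of `x_i` after the `U`-arrows of weight `a` are given length `s a`. -/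
def relengthGr (L : List ℤ) (s : ℕ → ℕ) (i : ℕ) : ℤ :=
  ∑ k ∈ Finset.range i,
    if k % 2 = 0 then
      if L.getD k 0 < 0 then 2 * (s (L.getD k 0).natAbs : ℤ) - 1
      else 1 - 2 * (s (L.getD k 0).natAbs : ℤ)
    else if L.getD k 0 < 0 then -1 else 1

theorem stdMatching_isZigzag {L : List ℤ} (hL : IsStdSeq L) (s : ℕ → ℕ) :
    (stdMatching L 0).IsZigzag (stdMatching L 1) s (fun i => relengthGr L s i)
      (Fin.last L.length) 0 := by
  obtain ⟨hne, heven⟩ := hL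
  have heven' : L.length % 2 = 0 := Nat.even_iff.1 heven
  have hz : ∀ i, L.getD i 0 = 0 ↔ L.length ≤ i := fun i =>
    ⟨fun h => by by_contra h'; exact getD_ne_zero hne (not_le.1 h') h, getD_eq_zero_of_le⟩
  have hstep : ∀ k, relengthGr L s (k + 1) = relengthGr L s k + _ := fun k =>
    Finset.sum_range_succ _ _
  refine ⟨fun i => ?_, fun i => ?_, fun i hi => ?_, fun i hi => ?_, ?_, fun P h0 hA hB => ?_⟩
  · have := i.isLt
    simp only [stdMatching, stdSign_eq_zero_iff, edgeParam, Fin.ext_iff, Fin.val_last]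
    split_ifs <;> grind
  · have := i.isLt
    simp only [stdMatching, stdSign_eq_zero_iff, edgeParam, Fin.ext_iff, Fin.val_zero]
    split_ifs <;> grind
  · simp only [stdMatching, stdSign_eq_one_iff, stdPartner_val, edgeParam] at hi ⊢
    rcases hi with ⟨h1, h2⟩ | ⟨h1, h2, h3⟩
    · have := lt_length_of_getD_ne_zero h2.ne
      simp only [h1, this, if_true, hstep]
      simp only [show (i : ℕ) % 2 = 0 by omega, h2, if_true]
      ring
    · obtain ⟨k, hk⟩ := Nat.exists_eq_succ_of_ne_zero h2
      simp only [hk, Nat.succ_eq_add_one, Nat.add_sub_cancel] at h1 h3 ⊢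
      simp only [h1, if_false, hstep, h3.not_gt, show k % 2 = 0 by omega, if_true,
        show ¬ k + 1 = 0 by omega]
      ring
  · simp only [stdMatching, stdSign_eq_one_iff, stdPartner_val] at hi ⊢
    rcases hi with ⟨h1, h2⟩ | ⟨h1, h2, h3⟩
    · have := lt_length_of_getD_ne_zero h2.ne
      simp only [h1, this, if_true, hstep]
      simp only [show ¬ (i : ℕ) % 2 = 0 by omega, h2, if_true, if_false]
      ring
    · obtain ⟨k, hk⟩ := Nat.exists_eq_succ_of_ne_zero h2
      simp only [hk, Nat.succ_eq_add_one, Nat.add_sub_cancel] at h1 h3 ⊢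
      simp only [h1, if_false, hstep, h3.not_gt, show ¬ k % 2 = 0 by omega]
      simp
  · simp [relengthGr]
  · have key : ∀ k (hk : k < L.length + 1), P ⟨k, hk⟩ := by
      intro k
      induction k with
      | zero => intro _; exact h0
      | succ k ih =>
        intro hk
        have ih := ih (by omega)
        rcases Nat.mod_two_eq_zero_or_one k with h | h
        · convert hA _ ih using 1
          simp [stdMatching, Fin.ext_iff, stdPartner_val, h, show k < L.length by omega]
        · convert hB _ ih using 1
          simp [stdMatching, Fin.ext_iff, stdPartner_val, show (k + 1) % 2 = 0 by omega,
            show k < L.length by omega]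
    exact key _ _

end

section

lemma RUV_ringHom_ext {S : Type} [CommRing S] {f g : RUV →+* S} (hU : f Uv = g Uv)
    (hV : f Vv = g Vv) : f = g := by
  refine Ideal.Quotient.ringHom_ext (MvPolynomial.ringHom_ext (fun r => ?_) fun i => ?_)
  · exact congrArg (fun h : ZMod 2 →+* S => h r) (Subsingleton.elim
      ((f.comp (Ideal.Quotient.mk IUV)).comp MvPolynomial.C)
      ((g.comp (Ideal.Quotient.mk IUV)).comp MvPolynomial.C))
  · fin_cases i
    · exact hU
    · exact hV

/-- The ring homomorphism from `R` with prescribed images of `U` and `V`. -/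
def evalUV {S : Type} [CommRing S] [Algebra (ZMod 2) S] (u v : S) (h : u * v = 0) : RUV →+* S :=
  Ideal.Quotient.lift IUV (MvPolynomial.aeval ![u, v]).toRingHom (by
    have : IUV ≤ RingHom.ker (MvPolynomial.aeval (R := ZMod 2) ![u, v]).toRingHom := by
      rw [IUV, Ideal.span_le, Set.singleton_subset_iff]
      simp [RingHom.mem_ker, h]
    exact fun a ha => this ha)

lemma evalUV_Uv {S : Type} [CommRing S] [Algebra (ZMod 2) S] (u v : S) (h : u * v = 0) :
    evalUV u v h Uv = u := by
  simp [evalUV, Uv]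

lemma evalUV_Vv {S : Type} [CommRing S] [Algebra (ZMod 2) S] (u v : S) (h : u * v = 0) :
    evalUV u v h Vv = v := by
  simp [evalUV, Vv]

/-- Reduction modulo `V`. -/
def projU : RUV →+* (ZMod 2)[X] := evalUV X 0 (mul_zero _)

/-- Reduction modulo `U`. -/
def projV : RUV →+* (ZMod 2)[X] := evalUV 0 X (zero_mul _)

lemma projU_Uv : projU Uv = X := evalUV_Uv _ _ _
lemma projU_Vv : projU Vv = 0 := evalUV_Vv _ _ _
lemma projV_Uv : projV Uv = 0 := evalUV_Uv _ _ _
lemma projV_Vv : projV Vv = X := evalUV_Vv _ _ _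

lemma constantCoeff_comp_proj : constantCoeff.comp projU = constantCoeff.comp projV := by
  apply RUV_ringHom_ext <;> simp [projU_Uv, projU_Vv, projV_Uv, projV_Vv]

lemma exists_eq_Uv_mul {r : RUV} (h : projV r = 0) : ∃ t, r = Uv * t := by
  let q := Ideal.Quotient.mk (Ideal.span {Uv})
  have hq : q Uv = 0 := Ideal.Quotient.eq_zero_iff_mem.2 (Ideal.subset_span rfl)
  let ι : (ZMod 2)[X] →+* RUV := (Polynomial.aeval Vv).toRingHom
  have key : (q.comp ι).comp projV = q := by
    apply RUV_ringHom_ext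
    · simp [projV_Uv, hq]
    · simp [projV_Vv, ι]
  have := congrArg (fun f : RUV →+* _ => f r) key
  simp only [RingHom.comp_apply, h, map_zero] at this
  obtain ⟨t, ht⟩ := Ideal.mem_span_singleton'.1 (Ideal.Quotient.eq_zero_iff_mem.1 this.symm)
  exact ⟨t, by rw [← ht, mul_comm]⟩

/-- The matrix of a linear map, with rows indexed by the source. -/
def mat {C C' : PreCx} (f : Msub C →ₗ[RUV] Msub C') : Matrix (Fin C.n) (Fin C'.n) RUV :=
  Matrix.of fun i j => f (Finsupp.single i 1) j

lemma apply_eq_vecMul {C C' : PreCx} (f : Msub C →ₗ[RUV] Msub C') (x : Msub C) :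
    ⇑(f x) = ⇑x ᵥ* mat f := by
  ext k
  induction x using Finsupp.induction_linear with
  | zero => simp
  | add x y hx hy => simp [Matrix.add_vecMul, hx, hy]
  | single i r =>
    rw [← mul_one r, ← smul_eq_mul, ← Finsupp.smul_single, map_smul]
    simp [Finsupp.single_eq_pi_single, mat]

lemma mat_comp {C C' C'' : PreCx} (g : Msub C' →ₗ[RUV] Msub C'') (f : Msub C →ₗ[RUV] Msub C') :
    mat (g ∘ₗ f) = mat f * mat g := by
  ext i k
  simp only [mat, Matrix.of_apply, LinearMap.comp_apply]
  rw [apply_eq_vecMul]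
  rfl

lemma mat_dmap (C : PreCx) : mat (dmap C) = Matrix.of C.dm := by
  ext i j
  simp [mat, dmap, Finsupp.finsetSum_apply, Finsupp.single_apply]

lemma IsLocalMap.mat_chain {C C' : PreCx} {f : Msub C →ₗ[RUV] Msub C'} (h : IsLocalMap C C' f) :
    Matrix.of C.dm * mat f = mat f * Matrix.of C'.dm := by
  rw [← mat_dmap, ← mat_dmap, ← mat_comp, ← mat_comp]
  exact congrArg mat (LinearMap.ext h.chain)

lemma mem_uSub_iff (C : PreCx) (x : Msub C) : x ∈ uSub C ↔ ∀ j, projV (x j) = 0 := by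
  constructor
  · rintro ⟨y, rfl⟩ j
    simp [projV_Uv]
  · intro h
    choose t ht using fun j => exists_eq_Uv_mul (h j)
    exact ⟨Finsupp.equivFunOnFinite.symm t, by ext j; simp [← ht]⟩

/-- A functional on `C/U` vanishing on boundaries. -/
def IsCocycle (C : PreCx) (α : Fin C.n → (ZMod 2)[X]) : Prop :=
  (Matrix.of C.dm).map projV *ᵥ α = 0

/-- The value of a functional on a chain modulo `U`. -/
def pair {C : PreCx} (x : Msub C) (α : Fin C.n → (ZMod 2)[X]) : (ZMod 2)[X] :=
  (projV ∘ x) ⬝ᵥ α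

lemma pair_sub {C : PreCx} (x y : Msub C) (α : Fin C.n → (ZMod 2)[X]) :
    pair (x - y) α = pair x α - pair y α := by
  simp [pair, dotProduct, sub_mul]

lemma pair_add {C : PreCx} (x y : Msub C) (α : Fin C.n → (ZMod 2)[X]) :
    pair (x + y) α = pair x α + pair y α := by
  simp [pair, dotProduct, add_mul, Finset.sum_add_distrib]

lemma pair_smul {C : PreCx} (r : RUV) (x : Msub C) (α : Fin C.n → (ZMod 2)[X]) :
    pair (r • x) α = projV r * pair x α := by
  simp [pair, dotProduct, Finset.mul_sum, mul_assoc]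

lemma pair_apply {C C' : PreCx} (f : Msub C →ₗ[RUV] Msub C') (x : Msub C)
    (α : Fin C'.n → (ZMod 2)[X]) : pair (f x) α = pair x ((mat f).map projV *ᵥ α) := by
  have : projV ∘ ⇑(f x) = (projV ∘ ⇑x) ᵥ* (mat f).map projV := by
    rw [apply_eq_vecMul]
    exact funext fun j => RingHom.map_vecMul projV _ _ j
  rw [pair, pair, this, Matrix.dotProduct_mulVec]

lemma IsCocycle.pair_eq_zero {C : PreCx} {α : Fin C.n → (ZMod 2)[X]} (hα : IsCocycle C α)
    {x : Msub C} (hx : x ∈ bdryU C) : pair x α = 0 := by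
  obtain ⟨a, ha, b, ⟨z, rfl⟩, rfl⟩ := Submodule.mem_sup.1 hx
  have h1 : pair a α = 0 := by simp [pair, dotProduct, (mem_uSub_iff C a).1 ha]
  have h2 : pair (dmap C z) α = 0 := by
    rw [pair_apply, mat_dmap, hα]
    simp [pair]
  rw [pair_add, h1, h2, add_zero]

lemma IsCocycle.comp {C C' : PreCx} {f : Msub C →ₗ[RUV] Msub C'} (hf : IsLocalMap C C' f)
    {α : Fin C'.n → (ZMod 2)[X]} (hα : IsCocycle C' α) :
    IsCocycle C ((mat f).map projV *ᵥ α) := by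
  unfold IsCocycle at *
  rw [Matrix.mulVec_mulVec, ← Matrix.map_mul, hf.mat_chain, Matrix.map_mul, ← Matrix.mulVec_mulVec,
    hα, Matrix.mulVec_zero]

/-- All cocycles take proportional values on a cycle and on a tower generator. -/
lemma IsVTowerGen.exists_pair_eq {C : PreCx} {w z : Msub C} (hw : IsVTowerGen C w)
    (hz : dmap C z ∈ uSub C) :
    ∃ p : (ZMod 2)[X], ∀ α, IsCocycle C α → pair z α = p * pair w α := by
  obtain ⟨r, k, hk⟩ := hw.2.2 z hz
  refine ⟨projV r, fun α hα => ?_⟩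
  have := hα.pair_eq_zero hk
  rw [pair_smul, pair_sub, pair_smul, map_pow, projV_Vv] at this
  exact sub_eq_zero.1 ((mul_eq_zero.1 this).resolve_left (pow_ne_zero _ X_ne_zero))

lemma of_stdDm_map_projU (L : List ℤ) :
    (Matrix.of (stdDm L)).map projU = (stdMatching L 0).D id := by
  have key : ∀ (k : ℕ) (b : ℤ), b ≠ 0 →
      projU ((if k % 2 = 0 then Uv else Vv) ^ b.natAbs) =
        if (k + 0) % 2 = 0 then X ^ b.natAbs else 0 := fun k b hb => by
    rw [map_pow, apply_ite projU, projU_Uv, projU_Vv, add_zero]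
    split_ifs <;> simp [hb]
  ext1 i j
  rw [stdMatching_D_apply, Matrix.map_apply, Matrix.of_apply, stdDm, apply_ite projU,
    apply_ite projU, map_zero]
  exact ite_congr rfl (fun h => key _ _ h.2.ne) fun _ =>
    ite_congr rfl (fun h => key _ _ h.2.ne') fun _ => rfl

lemma of_stdDm_map_projV (L : List ℤ) :
    (Matrix.of (stdDm L)).map projV = (stdMatching L 1).D id := by
  have key : ∀ (k : ℕ) (b : ℤ), b ≠ 0 →
      projV ((if k % 2 = 0 then Uv else Vv) ^ b.natAbs) =
        if (k + 1) % 2 = 0 then X ^ b.natAbs else 0 := fun k b hb => by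
    rw [map_pow, apply_ite projV, projV_Uv, projV_Vv]
    rcases Nat.mod_two_eq_zero_or_one k with h | h
    · simp [h, hb, show (k + 1) % 2 = 1 by omega]
    · simp [h, show (k + 1) % 2 = 0 by omega]
  ext1 i j
  rw [stdMatching_D_apply, Matrix.map_apply, Matrix.of_apply, stdDm, apply_ite projV,
    apply_ite projV, map_zero]
  exact ite_congr rfl (fun h => key _ _ h.2.ne) fun _ =>
    ite_congr rfl (fun h => key _ _ h.2.ne') fun _ => rfl

lemma pair_single_one {C : PreCx} (x : Msub C) (i : Fin C.n) :
    pair x (Pi.single i 1) = projV (x i) :=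
  dotProduct_single_one _ _

/-- If the differential modulo `U` is given by a matching, the coefficient of an unmatched generator
is a cocycle. -/
lemma isCocycle_single {C : PreCx} {m : Matching (Fin C.n)}
    (hm : (Matrix.of C.dm).map projV = m.D id) {v : Fin C.n} (hv : m.sg v = 0) :
    IsCocycle C (Pi.single v 1) := by
  rw [IsCocycle, hm, Matrix.mulVec_single_one]
  ext1 i
  simp only [Matrix.col_apply, Matching.D, Matching.coef, Matrix.of_apply, Pi.zero_apply]
  split_ifs with h1 h2
  · have := m.sg_σ i
    rw [← h1, hv, h2] at this
    exact absurd this (by decide)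
  · rfl
  · rfl

/-- If the differential modulo `U` is given by a matching with a single unmatched generator, this
generator is a tower generator. -/
lemma isVTowerGen_single {C : PreCx} {m : Matching (Fin C.n)}
    (hm : (Matrix.of C.dm).map projV = m.D id) {v : Fin C.n} (hv : ∀ i, m.sg i = 0 ↔ i = v) :
    IsVTowerGen C (Finsupp.single v 1) := by
  have hσ : m.σ v = v := by rw [← hv, m.sg_σ, (hv v).2 rfl]; rfl
  have hd : ∀ (x : Msub C) (j : Fin C.n),
      projV (dmap C x j) = projV (x (m.σ j)) * m.coef id (m.σ j) := fun x j => by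
    rw [apply_eq_vecMul, mat_dmap, RingHom.map_vecMul, hm]
    simp [Matrix.vecMul, dotProduct, Matching.D, m.eq_σ_iff _ j]
  refine ⟨?_, fun k hk => ?_, fun z hz => ?_⟩
  · rw [mem_uSub_iff]
    intro j
    rw [hd, Finsupp.single_apply]
    split_ifs with h
    · rw [← h, Matching.coef, (hv v).2 rfl]
      simp
    · simp
  · have := (isCocycle_single hm ((hv v).2 rfl)).pair_eq_zero hk
    rw [pair_smul, pair_single_one, Finsupp.single_eq_same, map_one, mul_one, map_pow,
      projV_Vv] at this
    exact pow_ne_zero _ X_ne_zero this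
  · rw [mem_uSub_iff] at hz
    have key : ∀ j, j ≠ v → Vv ^ m.w j • Finsupp.single j (z j) ∈ bdryU C := by
      intro j hj
      rcases m.sg_cases j with h | h | h
      · exact absurd ((hv j).1 h) hj
      · have h1 := hz (m.σ j)
        rw [hd, m.invol, Matching.coef, if_pos h] at h1
        have h2 := (mul_eq_zero.1 h1).resolve_right (pow_ne_zero _ X_ne_zero)
        refine Submodule.smul_mem _ _ (Submodule.mem_sup_left ((mem_uSub_iff C _).2 fun i => ?_))
        rw [Finsupp.single_apply]
        split_ifs
        · exact h2
        · simp
      · have h1 : Vv ^ m.w j • Finsupp.single j 1 - dmap C (Finsupp.single (m.σ j) 1) ∈ uSub C := by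
          rw [mem_uSub_iff]
          intro i
          rw [Finsupp.sub_apply, map_sub, hd, Finsupp.smul_apply, Finsupp.single_apply,
            Finsupp.single_apply, smul_eq_mul, map_mul, map_pow, projV_Vv]
          by_cases hij : j = i
          · subst hij
            simp [Matching.coef, m.sg_σ, h, m.w_σ]
          · have : m.σ j ≠ m.σ i := fun e => hij (by rw [← m.invol j, e, m.invol])
            simp [hij, this]
        have h2 : Vv ^ m.w j • Finsupp.single j (1 : RUV) ∈ bdryU C := by
          rw [← sub_add_cancel (Vv ^ m.w j • Finsupp.single j (1 : RUV))
            (dmap C (Finsupp.single (m.σ j) 1))]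
          exact Submodule.add_mem_sup h1 ⟨_, rfl⟩
        have h3 := Submodule.smul_mem _ (z j) h2
        rwa [smul_comm, Finsupp.smul_single, smul_eq_mul, mul_one] at h3
    refine ⟨z v, ∑ j, m.w j, ?_⟩
    have hsum : z - z v • Finsupp.single v 1 = ∑ j ∈ Finset.univ.erase v, Finsupp.single j (z j) := by
      rw [sub_eq_iff_eq_add, Finsupp.smul_single, smul_eq_mul, mul_one,
        Finset.sum_erase_add _ (fun j => Finsupp.single j (z j)) (Finset.mem_univ v),
        Finsupp.univ_sum_single]
    rw [hsum, Finset.smul_sum]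
    refine Submodule.sum_mem _ fun j hj => ?_
    rw [← Finset.sum_erase_add _ _ (Finset.mem_univ j), pow_add, mul_smul]
    exact Submodule.smul_mem _ _ (key j (Finset.ne_of_mem_erase hj))

end

section

lemma relengthGr_sub {j : ℕ} (hj : 1 ≤ j) (L : List ℤ) :
    relengthGr L (fun a => 2 * a + if a = j then 1 else 0) L.length -
      relengthGr L (fun a => 2 * a) L.length = -2 * phi j L := by
  rw [relengthGr, relengthGr, phi, ← Finset.sum_sub_distrib, Finset.mul_sum]
  refine Finset.sum_congr rfl fun k _ => ?_
  push_cast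
  split_ifs <;> omega

/-- Local maps in both directions between a standard complex and a tensor product of standard
complexes, given by matrices, force additivity of `phi`. -/
theorem phi_eq_add_of_matrices {j : ℕ} (hj : 1 ≤ j) {L₁ L₂ L₃ : List ℤ} (h₁ : IsStdSeq L₁)
    (h₂ : IsStdSeq L₂) (h₃ : IsStdSeq L₃)
    {M : Matrix (Fin (L₃.length + 1)) (Fin (L₁.length + 1) × Fin (L₂.length + 1)) RUV}
    {N : Matrix (Fin (L₁.length + 1) × Fin (L₂.length + 1)) (Fin (L₃.length + 1)) RUV}
    (hM : Matrix.of (stdDm L₃) * M =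
      M * (Matrix.of (stdDm L₁) ⊗ₖ 1 + 1 ⊗ₖ Matrix.of (stdDm L₂)))
    (hN : (Matrix.of (stdDm L₁) ⊗ₖ 1 + 1 ⊗ₖ Matrix.of (stdDm L₂)) * N =
      N * Matrix.of (stdDm L₃))
    (hM0 : IsUnit (projV (M 0 (0, 0)))) (hN0 : IsUnit (projV (N (0, 0) 0))) :
    phi j L₃ = phi j L₁ + phi j L₂ := by
  have hadd : ∀ f : RUV →+* (ZMod 2)[X],
      (Matrix.of (stdDm L₁) ⊗ₖ (1 : Matrix (Fin (L₂.length + 1)) (Fin (L₂.length + 1)) RUV) +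
        (1 : Matrix (Fin (L₁.length + 1)) (Fin (L₁.length + 1)) RUV) ⊗ₖ
          Matrix.of (stdDm L₂)).map f =
      (Matrix.of (stdDm L₁)).map f ⊗ₖ 1 + 1 ⊗ₖ (Matrix.of (stdDm L₂)).map f := fun f => by
    ext1 p q
    simp [Matrix.kroneckerMap_apply, Matrix.one_apply, apply_ite f]
  have hU := hadd projU
  have hV := hadd projV
  rw [of_stdDm_map_projU, of_stdDm_map_projU] at hU
  rw [of_stdDm_map_projV, of_stdDm_map_projV] at hV
  have hcc : ∀ {I J : Type} (P : Matrix I J RUV),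
      (P.map projU).map constantCoeff = (P.map projV).map constantCoeff := fun P => by
    ext1 p q
    exact congrArg (fun f : RUV →+* ZMod 2 => f (P p q)) constantCoeff_comp_proj
  have hunit : ∀ {q : (ZMod 2)[X]}, IsUnit q → q.coeff 0 ≠ 0 := fun h =>
    (h.map constantCoeff).ne_zero
  have main : ∀ s : ℕ → ℕ, StrictMono s → relengthGr L₃ s L₃.length =
      relengthGr L₁ s L₁.length + relengthGr L₂ s L₂.length := fun s hs => by
    have hMU := congrArg (fun P => P.map projU) hM
    have hMV := congrArg (fun P => P.map projV) hM
    have hNU := congrArg (fun P => P.map projU) hN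
    have hNV := congrArg (fun P => P.map projV) hN
    simp only [Matrix.map_mul, hU, hV, of_stdDm_map_projU, of_stdDm_map_projV] at hMU hMV hNU hNV
    have := Matching.gr_eq_add hs (stdMatching_isZigzag h₃ s) (stdMatching_isZigzag h₁ s)
      (stdMatching_isZigzag h₂ s) hMU hMV hNU hNV (hcc M) (hcc N) (hunit hM0) (hunit hN0)
    exact this
  have e₁ := main (fun a => 2 * a) fun a b h => by simpa using h
  have e₂ := main (fun a => 2 * a + if a = j then 1 else 0) fun a b h => by
    simp only; split_ifs <;> omega
  have := relengthGr_sub hj L₁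
  have := relengthGr_sub hj L₂
  have := relengthGr_sub hj L₃
  linarith

/-- The unmatched generator `x_0` of a standard complex. -/
def stdBase (L : List ℤ) : Fin (StdCx L).n := (0 : Fin (L.length + 1))

lemma stdSign_eq_zero_iff_eq_zero {L : List ℤ} (hL : IsStdSeq L) (i : Fin (L.length + 1)) :
    (stdMatching L 1).sg i = 0 ↔ i = 0 :=
  (stdMatching_isZigzag hL id).unmatched_right i

lemma isVTowerGen_stdBase {L : List ℤ} (hL : IsStdSeq L) :
    IsVTowerGen (StdCx L) (Finsupp.single (stdBase L) 1) :=
  isVTowerGen_single (C := StdCx L) (of_stdDm_map_projV L) (stdSign_eq_zero_iff_eq_zero hL)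

lemma isCocycle_stdBase {L : List ℤ} (hL : IsStdSeq L) :
    IsCocycle (StdCx L) (Pi.single (stdBase L) 1) :=
  isCocycle_single (C := StdCx L) (of_stdDm_map_projV L) ((stdSign_eq_zero_iff_eq_zero hL 0).2 rfl)

lemma IsVTowerGen.isUnit_apply {L : List ℤ} (hL : IsStdSeq L) {y : Msub (StdCx L)}
    (hy : IsVTowerGen (StdCx L) y) : IsUnit (projV (y (stdBase L))) := by
  obtain ⟨p, hp⟩ := hy.exists_pair_eq (isVTowerGen_stdBase hL).1
  have := hp _ (isCocycle_stdBase hL)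
  rw [pair_single_one, pair_single_one, Finsupp.single_eq_same, map_one] at this
  exact IsUnit.of_mul_eq_one_right p this.symm

variable {C₁ C₂ : PreCx}

/-- The indexing of the basis of a tensor product. -/
def tensorEquiv (C₁ C₂ : PreCx) : Fin C₁.n × Fin C₂.n ≃ Fin (tensorCx C₁ C₂).n :=
  finProdFinEquiv

lemma tensorCx_dm_apply (i k) (i' k') :
    (tensorCx C₁ C₂).dm ((tensorEquiv C₁ C₂) (i, k)) ((tensorEquiv C₁ C₂) (i', k')) =
      (if k = k' then C₁.dm i i' else 0) + if i = i' then C₂.dm k k' else 0 := by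
  show (if ((tensorEquiv C₁ C₂).symm _).2 = ((tensorEquiv C₁ C₂).symm _).2 then
      C₁.dm ((tensorEquiv C₁ C₂).symm _).1 ((tensorEquiv C₁ C₂).symm _).1 else 0) +
    (if ((tensorEquiv C₁ C₂).symm _).1 = ((tensorEquiv C₁ C₂).symm _).1 then
      C₂.dm ((tensorEquiv C₁ C₂).symm _).2 ((tensorEquiv C₁ C₂).symm _).2 else 0) = _
  simp only [Equiv.symm_apply_apply]

lemma tensorCx_dm_submatrix (C₁ C₂ : PreCx) :
    (Matrix.of (tensorCx C₁ C₂).dm).submatrix (tensorEquiv C₁ C₂) (tensorEquiv C₁ C₂) =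
      Matrix.of C₁.dm ⊗ₖ 1 + 1 ⊗ₖ Matrix.of C₂.dm := by
  ext ⟨a, b⟩ ⟨c, d⟩
  simp [tensorCx_dm_apply, Matrix.one_apply]

/-- The chain `z₁ ⊗ z₂` of a tensor product. -/
def tensorChain (z₁ : Msub C₁) (z₂ : Msub C₂) : Msub (tensorCx C₁ C₂) :=
  Finsupp.equivFunOnFinite.symm fun p =>
    z₁ ((tensorEquiv C₁ C₂).symm p).1 * z₂ ((tensorEquiv C₁ C₂).symm p).2

lemma tensorChain_apply (z₁ : Msub C₁) (z₂ : Msub C₂) (i : Fin C₁.n) (k : Fin C₂.n) :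
    tensorChain z₁ z₂ ((tensorEquiv C₁ C₂) (i, k)) = z₁ i * z₂ k := by
  simp [tensorChain]

/-- The functional `α₁ ⊗ α₂` on a tensor product. -/
def tensorFunctional (α₁ : Fin C₁.n → (ZMod 2)[X]) (α₂ : Fin C₂.n → (ZMod 2)[X]) :
    Fin (tensorCx C₁ C₂).n → (ZMod 2)[X] :=
  fun p => α₁ ((tensorEquiv C₁ C₂).symm p).1 * α₂ ((tensorEquiv C₁ C₂).symm p).2

lemma sum_tensorCx {A : Type} [AddCommMonoid A] (f : Fin (tensorCx C₁ C₂).n → A) :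
    ∑ p, f p = ∑ i : Fin C₁.n, ∑ k : Fin C₂.n, f ((tensorEquiv C₁ C₂) (i, k)) := by
  rw [← Fintype.sum_prod_type']
  exact (Equiv.sum_comp (tensorEquiv C₁ C₂) f).symm

lemma pair_tensorFunctional (w : Msub (tensorCx C₁ C₂)) (α₁ : Fin C₁.n → (ZMod 2)[X])
    (α₂ : Fin C₂.n → (ZMod 2)[X]) :
    pair w (tensorFunctional α₁ α₂) =
      ∑ i, ∑ k, projV (w ((tensorEquiv C₁ C₂) (i, k))) * (α₁ i * α₂ k) := by
  rw [pair, dotProduct, sum_tensorCx]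
  simp [tensorFunctional]

lemma pair_tensorChain (z₁ : Msub C₁) (z₂ : Msub C₂) (α₁ : Fin C₁.n → (ZMod 2)[X])
    (α₂ : Fin C₂.n → (ZMod 2)[X]) :
    pair (tensorChain z₁ z₂) (tensorFunctional α₁ α₂) = pair z₁ α₁ * pair z₂ α₂ := by
  rw [pair_tensorFunctional, pair, pair, dotProduct, dotProduct, Finset.sum_mul_sum]
  refine Finset.sum_congr rfl fun i _ => Finset.sum_congr rfl fun k _ => ?_
  rw [tensorChain_apply, map_mul]
  simp only [Function.comp_apply]
  ring

lemma dmap_apply (C : PreCx) (x : Msub C) (j : Fin C.n) : dmap C x j = ∑ i, x i * C.dm i j := by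
  rw [apply_eq_vecMul, mat_dmap]
  rfl

lemma dmap_tensorChain (z₁ : Msub C₁) (z₂ : Msub C₂) :
    dmap (tensorCx C₁ C₂) (tensorChain z₁ z₂) =
      tensorChain (dmap C₁ z₁) z₂ + tensorChain z₁ (dmap C₂ z₂) := by
  ext p
  obtain ⟨⟨i, k⟩, rfl⟩ := (tensorEquiv C₁ C₂).surjective p
  rw [dmap_apply, sum_tensorCx, Finsupp.add_apply, tensorChain_apply, tensorChain_apply]
  simp only [tensorChain_apply, tensorCx_dm_apply, mul_add, Finset.sum_add_distrib, mul_ite,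
    mul_zero, Finset.sum_ite_eq', Finset.mem_univ, if_true]
  congr 1
  · rw [dmap_apply, Finset.sum_mul]
    exact Finset.sum_congr rfl fun _ _ => by ring
  · rw [Finset.sum_comm, dmap_apply, Finset.mul_sum]
    refine Finset.sum_congr rfl fun _ _ => ?_
    simp [mul_assoc]

lemma tensorChain_cycle {z₁ : Msub C₁} {z₂ : Msub C₂} (h₁ : dmap C₁ z₁ ∈ uSub C₁)
    (h₂ : dmap C₂ z₂ ∈ uSub C₂) :
    dmap (tensorCx C₁ C₂) (tensorChain z₁ z₂) ∈ uSub (tensorCx C₁ C₂) := by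
  rw [mem_uSub_iff] at *
  intro p
  obtain ⟨⟨i, k⟩, rfl⟩ := (tensorEquiv C₁ C₂).surjective p
  rw [dmap_tensorChain, Finsupp.add_apply, tensorChain_apply, tensorChain_apply]
  simp [h₁, h₂]

lemma isCocycle_iff (C : PreCx) (α : Fin C.n → (ZMod 2)[X]) :
    IsCocycle C α ↔ ∀ i, ∑ j, projV (C.dm i j) * α j = 0 :=
  funext_iff

lemma isCocycle_tensorFunctional {α₁ : Fin C₁.n → (ZMod 2)[X]} {α₂ : Fin C₂.n → (ZMod 2)[X]}
    (h₁ : IsCocycle C₁ α₁) (h₂ : IsCocycle C₂ α₂) :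
    IsCocycle (tensorCx C₁ C₂) (tensorFunctional α₁ α₂) := by
  rw [isCocycle_iff] at *
  intro p
  obtain ⟨⟨i, k⟩, rfl⟩ := (tensorEquiv C₁ C₂).surjective p
  rw [sum_tensorCx]
  have h : ∀ a b, tensorFunctional α₁ α₂ ((tensorEquiv C₁ C₂) (a, b)) = α₁ a * α₂ b := fun a b => by
    simp [tensorFunctional]
  simp only [h, tensorCx_dm_apply, map_add, apply_ite projV, map_zero, add_mul, ite_mul, zero_mul,
    Finset.sum_add_distrib, Finset.sum_ite_eq, Finset.mem_univ, if_true]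
  have e₁ : ∑ a, projV (C₁.dm i a) * (α₁ a * α₂ k) = 0 := by
    simp only [← mul_assoc, ← Finset.sum_mul, h₁ i, zero_mul]
  rw [e₁, Finset.sum_comm]
  simp only [Finset.sum_ite_eq, Finset.mem_univ, if_true, mul_left_comm _ (α₁ i), ← Finset.mul_sum,
    h₂ k, mul_zero, add_zero]

end

section

lemma IsLocalMap.isUnit_mat {L L' : List ℤ} (hL : IsStdSeq L) (hL' : IsStdSeq L')
    {f : Msub (StdCx L) →ₗ[RUV] Msub (StdCx L')} (hf : IsLocalMap (StdCx L) (StdCx L') f) :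
    IsUnit (projV (mat f (stdBase L) (stdBase L'))) :=
  (hf.towers _ (isVTowerGen_stdBase hL)).isUnit_apply hL'

/-- Local maps in both directions between two standard complexes, given by matrices, force equality
of `phi`. -/
theorem phi_eq_of_matrices {j : ℕ} (hj : 1 ≤ j) {L L' : List ℤ} (hL : IsStdSeq L)
    (hL' : IsStdSeq L') {M : Matrix (Fin (L'.length + 1)) (Fin (L.length + 1)) RUV}
    {N : Matrix (Fin (L.length + 1)) (Fin (L'.length + 1)) RUV}
    (hM : Matrix.of (stdDm L') * M = M * Matrix.of (stdDm L))
    (hN : Matrix.of (stdDm L) * N = N * Matrix.of (stdDm L'))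
    (hM0 : IsUnit (projV (M 0 0))) (hN0 : IsUnit (projV (N 0 0))) : phi j L = phi j L' := by
  have hnil : IsStdSeq [] := ⟨by simp, by simp⟩
  have e : (Matrix.of (stdDm L) ⊗ₖ (1 : Matrix (Fin (([] : List ℤ).length + 1)) _ RUV) +
      (1 : Matrix (Fin (L.length + 1)) _ RUV) ⊗ₖ Matrix.of (stdDm [])) =
      (Matrix.of (stdDm L)).submatrix Prod.fst Prod.fst := by
    ext ⟨a, b⟩ ⟨c, d⟩
    obtain rfl : b = 0 := Subsingleton.elim (α := Fin 1) _ _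
    obtain rfl : d = 0 := Subsingleton.elim (α := Fin 1) _ _
    simp [stdDm]
  have hfst : Function.Bijective (Prod.fst : Fin (L.length + 1) × Fin (([] : List ℤ).length + 1) →
      Fin (L.length + 1)) := (Equiv.prodUnique _ (Fin 1)).bijective
  have := phi_eq_add_of_matrices hj hL hnil hL' (M := M.submatrix id Prod.fst)
    (N := N.submatrix Prod.fst id)
    (by
      rw [e, ← Matrix.submatrix_mul _ _ _ _ _ hfst, ← hM]
      rfl)
    (by
      rw [e, ← Matrix.submatrix_mul _ _ _ _ _ hfst, hN]
      rfl)
    hM0 hN0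
  simpa [phi] using this.symm

theorem phi_eq_of_localEquiv {j : ℕ} (hj : 1 ≤ j) {L L' : List ℤ} (hL : IsStdSeq L)
    (hL' : IsStdSeq L') (h : LocalEquiv (StdCx L) (StdCx L')) : phi j L = phi j L' := by
  obtain ⟨⟨f, hf⟩, ⟨g, hg⟩⟩ := h
  exact phi_eq_of_matrices hj hL hL' hg.mat_chain hf.mat_chain (hg.isUnit_mat hL' hL)
    (hf.isUnit_mat hL hL')

variable {C₁ C₂ : PreCx}

theorem phi_tensor {j : ℕ} (hj : 1 ≤ j) {L₁ L₂ L₃ : List ℤ} (h₁ : IsStdSeq L₁)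
    (h₂ : IsStdSeq L₂) (h₃ : IsStdSeq L₃) (hC₁ : LocalEquiv C₁ (StdCx L₁))
    (hC₂ : LocalEquiv C₂ (StdCx L₂)) (hT : LocalEquiv (tensorCx C₁ C₂) (StdCx L₃)) :
    phi j L₃ = phi j L₁ + phi j L₂ := by
  obtain ⟨⟨f₁, hf₁⟩, ⟨g₁, hg₁⟩⟩ := hC₁
  obtain ⟨⟨f₂, hf₂⟩, ⟨g₂, hg₂⟩⟩ := hC₂
  obtain ⟨⟨F, hF⟩, ⟨G, hG⟩⟩ := hT
  let G' := (mat G).submatrix id (tensorEquiv C₁ C₂)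
  let F' := (mat F).submatrix (tensorEquiv C₁ C₂) id
  have cF : (Matrix.of C₁.dm ⊗ₖ 1 + 1 ⊗ₖ Matrix.of C₂.dm) * F' =
      F' * Matrix.of (StdCx L₃).dm := by
    rw [← tensorCx_dm_submatrix, Matrix.submatrix_mul_equiv, hF.mat_chain]
    rfl
  have cG : Matrix.of (StdCx L₃).dm * G' =
      G' * (Matrix.of C₁.dm ⊗ₖ 1 + 1 ⊗ₖ Matrix.of C₂.dm) := by
    rw [← tensorCx_dm_submatrix, Matrix.submatrix_mul_equiv, ← hG.mat_chain]
    rfl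
  have cf : (Matrix.of C₁.dm ⊗ₖ 1 + 1 ⊗ₖ Matrix.of C₂.dm) * (mat f₁ ⊗ₖ mat f₂) =
      (mat f₁ ⊗ₖ mat f₂) *
        (Matrix.of (StdCx L₁).dm ⊗ₖ 1 + 1 ⊗ₖ Matrix.of (StdCx L₂).dm) := by
    simp only [Matrix.add_mul, Matrix.mul_add, ← Matrix.mul_kronecker_mul, hf₁.mat_chain,
      hf₂.mat_chain, Matrix.one_mul, Matrix.mul_one]
  have cg : (Matrix.of (StdCx L₁).dm ⊗ₖ 1 + 1 ⊗ₖ Matrix.of (StdCx L₂).dm) *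
      (mat g₁ ⊗ₖ mat g₂) =
      (mat g₁ ⊗ₖ mat g₂) * (Matrix.of C₁.dm ⊗ₖ 1 + 1 ⊗ₖ Matrix.of C₂.dm) := by
    simp only [Matrix.add_mul, Matrix.mul_add, ← Matrix.mul_kronecker_mul, hg₁.mat_chain,
      hg₂.mat_chain, Matrix.one_mul, Matrix.mul_one]
  have t₃ := isVTowerGen_stdBase h₃
  obtain ⟨p, hp⟩ := (hG.towers _ t₃).exists_pair_eq
    (tensorChain_cycle (hg₁.towers _ (isVTowerGen_stdBase h₁)).1
      (hg₂.towers _ (isVTowerGen_stdBase h₂)).1)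
  have hM := hp _ (isCocycle_tensorFunctional ((isCocycle_stdBase h₁).comp hf₁)
    ((isCocycle_stdBase h₂).comp hf₂))
  have hN := hp _ ((isCocycle_stdBase h₃).comp hF)
  rw [← pair_apply, ← pair_apply, pair_single_one, pair_single_one] at hN
  rw [pair_tensorChain, ← pair_apply, ← pair_apply, pair_single_one, pair_single_one] at hM
  have hu := ((hf₁.towers _ (hg₁.towers _ (isVTowerGen_stdBase h₁))).isUnit_apply h₁).mul
    ((hf₂.towers _ (hg₂.towers _ (isVTowerGen_stdBase h₂))).isUnit_apply h₂)
  rw [hM] at hu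
  have hu₃ := (isUnit_of_mul_isUnit_left hu).mul
    ((hF.towers _ (hG.towers _ t₃)).isUnit_apply h₃)
  rw [← hN] at hu₃
  have eM : Matrix.of (StdCx L₃).dm * (G' * (mat f₁ ⊗ₖ mat f₂)) = G' * (mat f₁ ⊗ₖ mat f₂) *
      (Matrix.of (StdCx L₁).dm ⊗ₖ 1 + 1 ⊗ₖ Matrix.of (StdCx L₂).dm) := by
    rw [← Matrix.mul_assoc, cG, Matrix.mul_assoc, cf, ← Matrix.mul_assoc]
  have eN : (Matrix.of (StdCx L₁).dm ⊗ₖ 1 + 1 ⊗ₖ Matrix.of (StdCx L₂).dm) *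
      ((mat g₁ ⊗ₖ mat g₂) * F') = (mat g₁ ⊗ₖ mat g₂) * F' * Matrix.of (StdCx L₃).dm := by
    rw [← Matrix.mul_assoc, cg, Matrix.mul_assoc, cF, ← Matrix.mul_assoc]
  have uM : IsUnit (projV ((G' * (mat f₁ ⊗ₖ mat f₂)) (stdBase L₃) (stdBase L₁, stdBase L₂))) := by
    convert isUnit_of_mul_isUnit_right hu using 1
    rw [pair_tensorFunctional, Matrix.mul_apply, map_sum, Fintype.sum_prod_type]
    refine Finset.sum_congr rfl fun i _ => Finset.sum_congr rfl fun k _ => ?_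
    rw [map_mul, Matrix.mulVec_single_one, Matrix.mulVec_single_one, Matrix.kroneckerMap_apply,
      map_mul]
    rfl
  have uN : IsUnit (projV (((mat g₁ ⊗ₖ mat g₂) * F') (stdBase L₁, stdBase L₂) (stdBase L₃))) := by
    convert hu₃ using 1
    rw [apply_eq_vecMul, Matrix.vecMul, dotProduct, sum_tensorCx, Matrix.mul_apply,
      Fintype.sum_prod_type]
    congr 1
    refine Finset.sum_congr rfl fun i _ => Finset.sum_congr rfl fun k _ => ?_
    rw [tensorChain_apply]
    rfl
  exact phi_eq_add_of_matrices hj h₁ h₂ h₃ eM eN uM uN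

end

end

/-- For each `j ∈ ℕ` (with `ℕ = ℤ_{>0}`) and any two knot-like
complexes `C₁, C₂`, one has `φ_j(C₁ ⊗_R C₂) = φ_j(C₁) + φ_j(C₂)`, where `φ_j` of a
knot-like complex is computed from (any) standard complex representative of its local
equivalence class.  Moreover `φ_j` is well defined on local equivalence classes, so it
descends to a group homomorphism `φ_j : KL → ℤ`. -/
theorem phi_is_homomorphism (j : ℕ) (hj : 1 ≤ j) :
    (∀ C₁ C₂ : PreCx, IsKnotLike C₁ → IsKnotLike C₂ →
      ∀ L₁ L₂ L₃ : List ℤ, IsStdSeq L₁ → IsStdSeq L₂ → IsStdSeq L₃ →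
        LocalEquiv C₁ (StdCx L₁) → LocalEquiv C₂ (StdCx L₂) →
        LocalEquiv (tensorCx C₁ C₂) (StdCx L₃) →
        phi j L₃ = phi j L₁ + phi j L₂) ∧
    (∀ L L' : List ℤ, IsStdSeq L → IsStdSeq L' →
      LocalEquiv (StdCx L) (StdCx L') → phi j L = phi j L') := by
  exact ⟨fun C₁ C₂ _ _ L₁ L₂ L₃ h₁ h₂ h₃ hC₁ hC₂ hT => phi_tensor hj h₁ h₂ h₃ hC₁ hC₂ hT,
    fun L L' hL hL' h => phi_eq_of_localEquiv hj hL hL' h⟩
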